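/- Let K be a field and Λ a balanced block. The multiplication mult of the Blanchet–Khovanov algebra A^F_Λ is homogeneous of degree 0 with respect to the grading by deg: if the basis vector underline λ ν″ overline η occurs with nonzero coefficient in mult((underline λ ν overline μ) ⊗ (underline μ ν′ overline η)), then deg(underline λ ν″ overline η) = deg(underline λ ν overline μ) + deg(underline μ ν′ overline η). -/

import Mathlib

namespace BK

/-- The symbols `∘, ×, ∨, ∧` labelling the integral positions of a weight. -/
inductive Symb : Type
  | circ : Symb
  | times : Symb
  | dn : Symb
  | up : Symb
  deriving DecidableEq

/-- A (diagrammatical) weight: a sequence of symbols indexed by `ℤ`, equal to `∘`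
for all but finitely many positions. -/
structure Weight : Type where
  lab : ℤ → Symb
  finite : {i : ℤ | lab i ≠ Symb.circ}.Finite

namespace Weight

/-- Two weights are equivalent (lie in the same block) if one is obtained from the
other by permuting the symbols `∧` and `∨`: the `∘`- and `×`-positions agree and the
number of `∧`'s agrees. -/
def Equiv (l m : Weight) : Prop :=
  (∀ i, l.lab i = Symb.circ ↔ m.lab i = Symb.circ) ∧
  (∀ i, l.lab i = Symb.times ↔ m.lab i = Symb.times) ∧
  {i | l.lab i = Symb.up}.ncard = {i | m.lab i = Symb.up}.ncard

/-- The vertices of (the block of) a weight: the positions carrying `∧` or `∨`,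
i.e. the positions where the block sequence has the symbol `★`. -/
def vertices (l : Weight) : Set ℤ :=
  {i | l.lab i = Symb.up ∨ l.lab i = Symb.dn}

/-- `up(Λ)`: the number of `∧`'s plus the number of `×`'s. -/
noncomputable def upNum (l : Weight) : ℕ :=
  {i | l.lab i = Symb.up}.ncard + {i | l.lab i = Symb.times}.ncard

/-- `down(Λ)`: the number of `∨`'s plus the number of `×`'s. -/
noncomputable def downNum (l : Weight) : ℕ :=
  {i | l.lab i = Symb.dn}.ncard + {i | l.lab i = Symb.times}.ncard

/-- A block is balanced if `up(Λ) = down(Λ)`. -/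
def Balanced (l : Weight) : Prop := l.upNum = l.downNum

end Weight

/-- A cup diagram (equally: the datum of a cap diagram, via the mirror image):
a set of cups `(i, j)` with `i < j` and a set of rays `i`. -/
@[ext]
structure CupDiagram : Type where
  cups : Set (ℤ × ℤ)
  rays : Set ℤ

namespace CupDiagram

/-- Compatibility of a cup diagram with the vertex set `V` of a block: endpoints lie in
`V` and are increasing, every vertex lies in exactly one arc, cups do not cross, and no
ray lies under a cup. -/
def IsCompatible (c : CupDiagram) (V : Set ℤ) : Prop :=
  (∀ p ∈ c.cups, p.1 < p.2) ∧
  (∀ p ∈ c.cups, p.1 ∈ V ∧ p.2 ∈ V) ∧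
  c.rays ⊆ V ∧
  (∀ v ∈ V, v ∈ c.rays ∨ ∃ p ∈ c.cups, v = p.1 ∨ v = p.2) ∧
  (∀ p ∈ c.cups, ∀ q ∈ c.cups,
    (p.1 = q.1 ∨ p.1 = q.2 ∨ p.2 = q.1 ∨ p.2 = q.2) → p = q) ∧
  (∀ p ∈ c.cups, p.1 ∉ c.rays ∧ p.2 ∉ c.rays) ∧
  (∀ p ∈ c.cups, ∀ q ∈ c.cups, ¬(p.1 < q.1 ∧ q.1 < p.2 ∧ p.2 < q.2)) ∧
  (∀ p ∈ c.cups, ∀ k ∈ c.rays, ¬(p.1 < k ∧ k < p.2))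

/-- The diagram `cλ` is oriented: every cup has exactly one endpoint `∨` and one `∧`,
every ray vertex is labeled `∨` or `∧`, and there are no rays `i < j` with
`λ_i = ∨` and `λ_j = ∧`. -/
def Oriented (c : CupDiagram) (l : Weight) : Prop :=
  (∀ p ∈ c.cups,
    (l.lab p.1 = Symb.dn ∧ l.lab p.2 = Symb.up) ∨
    (l.lab p.1 = Symb.up ∧ l.lab p.2 = Symb.dn)) ∧
  (∀ k ∈ c.rays, l.lab k = Symb.up ∨ l.lab k = Symb.dn) ∧
  (∀ i ∈ c.rays, ∀ j ∈ c.rays, i < j → ¬(l.lab i = Symb.dn ∧ l.lab j = Symb.up))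

/-- The degree of `cλ`: the number of clockwise cups (cups whose rightmost vertex is
labeled `∨`).  Applied to the mirror cap diagram this is the number of clockwise caps. -/
noncomputable def deg (c : CupDiagram) (l : Weight) : ℕ :=
  {p ∈ c.cups | l.lab p.2 = Symb.dn}.ncard

end CupDiagram

/-- `c` is the cup diagram `underline l` of the weight `l`: it is compatible with the
block of `l`, the diagram `c l` is oriented, and `deg (c l) = 0`. -/
def IsLowerDiagram (c : CupDiagram) (l : Weight) : Prop :=
  c.IsCompatible l.vertices ∧ c.Oriented l ∧ c.deg l = 0

/-- Adjacency of vertices in the circle diagram `c d*`: two vertices are adjacent when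
they are joined by a cup of `c` or a cap of `d*`. -/
def adjArc (c d : CupDiagram) (v w : ℤ) : Prop :=
  (v, w) ∈ c.cups ∨ (w, v) ∈ c.cups ∨ (v, w) ∈ d.cups ∨ (w, v) ∈ d.cups

/-- `S` is a connected component of the circle diagram `c d*`. -/
def IsComponent (c d : CupDiagram) (S : Set ℤ) : Prop :=
  ∃ v ∈ S, S = {w | Relation.ReflTransGen (adjArc c d) v w}

/-- `S` is a circle of the circle diagram `c d*`: a connected component containing
no ray. -/
def IsCircle (c d : CupDiagram) (S : Set ℤ) : Prop :=
  IsComponent c d S ∧ ∀ v ∈ S, v ∉ c.rays ∧ v ∉ d.rays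

/-- The degree of the oriented circle diagram `c n d*`: the number of clockwise cups
of `c n` plus the number of clockwise caps of `n d*`. -/
noncomputable def degCirc (c d : CupDiagram) (n : Weight) : ℕ :=
  {p ∈ c.cups | n.lab p.2 = Symb.dn}.ncard + {p ∈ d.cups | n.lab p.2 = Symb.dn}.ncard

/-- The position `p_Λ(i)` of `i` in the block of `l`. -/
noncomputable def posn (l : Weight) (i : ℤ) : ℕ :=
  {j | j ≤ i ∧ (l.lab j = Symb.up ∨ l.lab j = Symb.dn)}.ncard +
    2 * {j | j ≤ i ∧ l.lab j = Symb.times}.ncard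

/-- The distance `d_Λ(γ) = |p_Λ(i) − p_Λ(j)|` of an arc `γ = {i, j}`. -/
noncomputable def arcDist (l : Weight) (i j : ℤ) : ℕ := ((posn l i : ℤ) - (posn l j : ℤ)).natAbs


/-! ## The surgery multiplication of the Blanchet–Khovanov algebra

We model the intermediate diagrams `D_l = underline λ c* c overline η` of the surgery
procedure.  Points live on two horizontal lines (`false` = bottom, `true` = top);
the bottom cup diagram is `a = underline λ`, the top cap diagram is `e* = overline η`
(recorded by the cup diagram datum `e = underline η`), the middle part consists of the
caps `γ*` and cups `γ` for `γ` in the set `R` of middle cups not yet surgered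
(`R ⊆ dd.cups`, where `dd = underline μ`), together with a pair of vertical line
segments at both endpoints of every already surgered middle cup `γ ∈ dd.cups \ R`. -/

open scoped Classical

/-- A point of a stacked circle diagram: a vertex together with the line
(`false` = bottom line, `true` = top line) it lies on. -/
abbrev Pt := ℤ × Bool

/-- Adjacency of points of the stacked circle diagram: bottom cups of `a`, bottom caps
and top cups attached to the middle cups in `R`, top caps of `e*`, and the vertical
line segments at the endpoints of the already surgered middle cups. -/
def SAdj (a e dd : CupDiagram) (R : Set (ℤ × ℤ)) (p q : Pt) : Prop :=
  (p.2 = false ∧ q.2 = false ∧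
    ((p.1, q.1) ∈ a.cups ∨ (q.1, p.1) ∈ a.cups ∨ (p.1, q.1) ∈ R ∨ (q.1, p.1) ∈ R)) ∨
  (p.2 = true ∧ q.2 = true ∧
    ((p.1, q.1) ∈ R ∨ (q.1, p.1) ∈ R ∨ (p.1, q.1) ∈ e.cups ∨ (q.1, p.1) ∈ e.cups)) ∨
  (p.1 = q.1 ∧ p.2 ≠ q.2 ∧ ∃ g ∈ dd.cups, g ∉ R ∧ (p.1 = g.1 ∨ p.1 = g.2))

/-- The connected component of the point `p` in the stacked circle diagram. -/
def SComp (a e dd : CupDiagram) (R : Set (ℤ × ℤ)) (p : Pt) : Set Pt :=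
  {q | Relation.ReflTransGen (SAdj a e dd R) p q}

/-- The label of a point under an orientation `o = (ν_bottom, ν_top)` of the stacked
circle diagram. -/
def plab (o : Weight × Weight) (p : Pt) : Symb :=
  if p.2 then o.2.lab p.1 else o.1.lab p.1

/-- An arc `g` is oriented by the weight `w`: one endpoint `∨`, one endpoint `∧`. -/
def OneUpOneDn (w : Weight) (g : ℤ × ℤ) : Prop :=
  (w.lab g.1 = Symb.dn ∧ w.lab g.2 = Symb.up) ∨
  (w.lab g.1 = Symb.up ∧ w.lab g.2 = Symb.dn)

/-- `o = (ν_bottom, ν_top)` is an orientation of the stacked circle diagram: both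
weights lie in the block, all arcs are oriented and the two weights agree at the
vertical line segments. -/
def SOriented (l0 : Weight) (a e dd : CupDiagram) (R : Set (ℤ × ℤ))
    (o : Weight × Weight) : Prop :=
  l0.Equiv o.1 ∧ l0.Equiv o.2 ∧
  (∀ g ∈ a.cups, OneUpOneDn o.1 g) ∧
  (∀ g ∈ R, OneUpOneDn o.1 g) ∧
  (∀ g ∈ R, OneUpOneDn o.2 g) ∧
  (∀ g ∈ e.cups, OneUpOneDn o.2 g) ∧
  (∀ g ∈ dd.cups, g ∉ R →
    o.1.lab g.1 = o.2.lab g.1 ∧ o.1.lab g.2 = o.2.lab g.2)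

/-- `p` is a rightmost point `t(S)` of the component `S`. -/
def RightmostPt (S : Set Pt) (p : Pt) : Prop :=
  p ∈ S ∧ ∀ q ∈ S, q.1 ≤ p.1

/-- The circle `S` is clockwise: its rightmost point is labeled `∨`. -/
def IsClockwise (o : Weight × Weight) (S : Set Pt) : Prop :=
  ∃ p, RightmostPt S p ∧ plab o p = Symb.dn

/-- The circle `S` is anticlockwise: its rightmost point is labeled `∧`. -/
def IsAnticlockwise (o : Weight × Weight) (S : Set Pt) : Prop :=
  ∃ p, RightmostPt S p ∧ plab o p = Symb.up

/-- The number of arcs of the circle `S` crossed by a vertical ray going downwards from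
just below the point `p`: for a bottom point only the bottom cups of `S` spanning it,
for a top point also the middle caps and cups of `S` spanning it. -/
noncomputable def insideCount (a : CupDiagram) (R : Set (ℤ × ℤ)) (S : Set Pt)
    (p : Pt) : ℕ :=
  {g ∈ a.cups | ((g.1 : ℤ), false) ∈ S ∧ g.1 < p.1 ∧ p.1 < g.2}.ncard +
    (if p.2 then
      {g ∈ R | ((g.1 : ℤ), false) ∈ S ∧ g.1 < p.1 ∧ p.1 < g.2}.ncard +
        {g ∈ R | ((g.1 : ℤ), true) ∈ S ∧ g.1 < p.1 ∧ p.1 < g.2}.ncard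
    else 0)

/-- The circle `S` is nested inside the circle `T` (crossing-parity criterion). -/
def NestedIn (a : CupDiagram) (R : Set (ℤ × ℤ)) (S T : Set Pt) : Prop :=
  ∃ p ∈ S, Odd (insideCount a R T p)

/-- The total distance `d_Λ(C)` of the circle `S` of a stacked circle diagram: the sum
of the distances of all its arcs (vertical line segments having distance `0`). -/
noncomputable def sDist (l : Weight) (a e : CupDiagram) (R : Set (ℤ × ℤ))
    (S : Set Pt) : ℕ :=
  (∑ᶠ g ∈ {g ∈ a.cups | ((g.1 : ℤ), false) ∈ S}, arcDist l g.1 g.2) +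
    (∑ᶠ g ∈ {g ∈ R | ((g.1 : ℤ), false) ∈ S}, arcDist l g.1 g.2) +
    (∑ᶠ g ∈ {g ∈ R | ((g.1 : ℤ), true) ∈ S}, arcDist l g.1 g.2) +
    (∑ᶠ g ∈ {g ∈ e.cups | ((g.1 : ℤ), true) ∈ S}, arcDist l g.1 g.2)

/-- The total distance of a path along consecutive points (vertical segments
contributing `0`). -/
noncomputable def sPathDist (l : Weight) (vs : List Pt) : ℕ :=
  ((vs.zip vs.tail).map fun q =>
    if q.1.2 = q.2.2 then arcDist l q.1.1 q.2.1 else 0).sum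

/-- There is a path of pairwise distinct arcs from `p` to `q` of odd total distance. -/
def OddPathBetween (l : Weight) (a e dd : CupDiagram) (R : Set (ℤ × ℤ))
    (p q : Pt) : Prop :=
  ∃ vs : List Pt, vs.Chain' (SAdj a e dd R) ∧ vs.head? = some p ∧
    vs.getLast? = some q ∧ vs.Nodup ∧ Odd (sPathDist l vs)

/-- The dot moving sign `(−1)^{d_Λ(γ^{dot})}` for a sequence of arcs connecting the
rightmost points `t(S)` and `t(T)`. -/
noncomputable def rmSign (K : Type*) [Field K] (l : Weight) (a e dd : CupDiagram)
    (R : Set (ℤ × ℤ)) (S T : Set Pt) : K :=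
  if ∃ p q, RightmostPt S p ∧ RightmostPt T q ∧ OddPathBetween l a e dd R p q then -1
  else 1

/-- The dot moving sign `(−1)^{d_Λ(γ^{ndot})}` for a sequence of arcs connecting the
point `x` with the rightmost point `t(S)`. -/
noncomputable def ptSign (K : Type*) [Field K] (l : Weight) (a e dd : CupDiagram)
    (R : Set (ℤ × ℤ)) (x : Pt) (S : Set Pt) : K :=
  if ∃ q, RightmostPt S q ∧ OddPathBetween l a e dd R x q then -1 else 1

/-- The saddle width `s_Λ(γ) = (d_Λ(γ) + 1)/2`. -/
noncomputable def saddleW (l : Weight) (γ : ℤ × ℤ) : ℕ :=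
  (arcDist l γ.1 γ.2 + 1) / 2

/-- The coefficient with which the orientation `o′` of the stacked circle diagram
obtained by the surgery at the cup–cap pair of `γ` occurs in the image of the
orientation `o`; this encodes the merge and split rules (with dot moving signs,
saddle signs and topological signs) of the Blanchet–Khovanov multiplication. -/
noncomputable def stepCoeff (K : Type*) [Field K] (l0 : Weight) (a e dd : CupDiagram)
    (R : Set (ℤ × ℤ)) (γ : ℤ × ℤ) (o o' : Weight × Weight) : K :=
  let R' : Set (ℤ × ℤ) := R \ {γ}
  let Cbot := SComp a e dd R ((γ.1 : ℤ), false)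
  let Ctop := SComp a e dd R ((γ.1 : ℤ), true)
  if ¬ SOriented l0 a e dd R o ∨ ¬ SOriented l0 a e dd R' o' ∨
      ¬ (∀ p : Pt, p ∉ Cbot ∪ Ctop → plab o p = plab o' p) then 0
  else if Cbot ≠ Ctop then
    -- merge of the two circles `Cbot` and `Ctop` into the circle `C`
    let C := SComp a e dd R' ((γ.1 : ℤ), false)
    let base : K :=
      if NestedIn a R Ctop Cbot then
        -((-1 : K) ^ ((sDist l0 a e R Ctop - 2) / 4)) * (-1 : K) ^ saddleW l0 γ
      else if NestedIn a R Cbot Ctop then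
        -((-1 : K) ^ ((sDist l0 a e R Cbot - 2) / 4)) * (-1 : K) ^ saddleW l0 γ
      else 1
    if IsAnticlockwise o Cbot ∧ IsAnticlockwise o Ctop then
      (if IsAnticlockwise o' C then base else 0)
    else if IsClockwise o Cbot ∧ IsAnticlockwise o Ctop then
      (if IsClockwise o' C then base * rmSign K l0 a e dd R' Cbot C else 0)
    else if IsAnticlockwise o Cbot ∧ IsClockwise o Ctop then
      (if IsClockwise o' C then base * rmSign K l0 a e dd R' Ctop C else 0)
    else 0
  else
    -- split of the circle `C` into the circles `Ci` and `Cj`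
    let C := Cbot
    let Ci := SComp a e dd R' ((γ.1 : ℤ), false)
    let Cj := SComp a e dd R' ((γ.2 : ℤ), false)
    let Sfac : K :=
      if NestedIn a R' Ci Cj then (-1 : K) ^ ((sDist l0 a e R' Ci - 2) / 4)
      else if NestedIn a R' Cj Ci then (-1 : K) ^ ((sDist l0 a e R' Cj - 2) / 4)
      else (-1 : K) ^ saddleW l0 γ
    if IsAnticlockwise o C then
      if IsClockwise o' Ci ∧ IsAnticlockwise o' Cj then
        ptSign K l0 a e dd R' ((γ.1 : ℤ), false) Ci * Sfac
      else if IsAnticlockwise o' Ci ∧ IsClockwise o' Cj then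
        -(ptSign K l0 a e dd R' ((γ.2 : ℤ), false) Cj) * Sfac
      else 0
    else if IsClockwise o C then
      if IsClockwise o' Ci ∧ IsClockwise o' Cj then
        rmSign K l0 a e dd R C Cj * ptSign K l0 a e dd R' ((γ.1 : ℤ), false) Ci * Sfac
      else 0
    else 0

/-- Iterating the surgery procedure along the list `L` of chosen cup–cap pairs,
starting with the set `R` of middle cups and a formal `K`-linear combination of
orientations (recorded by its coefficient function). -/
noncomputable def multAlong (K : Type*) [Field K] (l0 : Weight) (a e dd : CupDiagram) :
    List (ℤ × ℤ) → Set (ℤ × ℤ) → ((Weight × Weight) → K) → ((Weight × Weight) → K)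
  | [], _, f => f
  | γ :: L, R, f =>
      multAlong K l0 a e dd L (R \ {γ})
        (fun o' => ∑ᶠ o : Weight × Weight, stepCoeff K l0 a e dd R γ o o' * f o)

/-- The coefficient function of the basis vector `underline λ ν overline μ ⊗
underline μ ν′ overline η`: the indicator of the orientation `(ν, ν′)`. -/
noncomputable def basisInit (K : Type*) [Field K] (ν ν' : Weight) :
    (Weight × Weight) → K :=
  fun o => if o = (ν, ν') then 1 else 0

/-- The cup–cap pair of `γ` is available for surgery: `γ` is a middle cup not yet
surgered and not nested inside any other remaining arc. -/
def Available (R : Set (ℤ × ℤ)) (γ : ℤ × ℤ) : Prop :=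
  γ ∈ R ∧ ¬ ∃ γ' ∈ R, γ' ≠ γ ∧ γ'.1 < γ.1 ∧ γ.2 < γ'.2

/-- `L` is an admissible order of surgeries on the set `R` of middle cups: each chosen
cup–cap pair is available at its step, and all pairs are surgered. -/
def IsAdmissibleOrder : List (ℤ × ℤ) → Set (ℤ × ℤ) → Prop
  | [], R => R = ∅
  | γ :: L, R => Available R γ ∧ IsAdmissibleOrder L (R \ {γ})

/-- `L` is the order of surgeries used in the definition of the multiplication: at each
step the available cup–cap pair with the leftmost endpoint is chosen. -/
def IsLeftmostOrder : List (ℤ × ℤ) → Set (ℤ × ℤ) → Prop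
  | [], R => R = ∅
  | γ :: L, R => Available R γ ∧ (∀ γ', Available R γ' → γ.1 ≤ γ'.1) ∧
      IsLeftmostOrder L (R \ {γ})


/-- `f` restricts to a fixed point free involution of `V` whose arcs `{x, f x}` do not cross
when the points are placed on a line according to the key `k`. -/
structure IsNCMatching {α : Type*} (k : α → ℤ) (V : Finset α) (f : α → α) : Prop where
  mem : ∀ x ∈ V, f x ∈ V
  invol : ∀ x ∈ V, f (f x) = x
  ne : ∀ x ∈ V, f x ≠ x
  nc : ∀ x ∈ V, ∀ u ∈ V, u ≠ x → u ≠ f x →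
    ((k x < k u ↔ k (f x) < k u) ↔ (k x < k (f u) ↔ k (f x) < k (f u)))

/-- The pair of maps `f`, `g` acts transitively on `V`. -/
def IsSingleOrbit {α : Type*} (V : Finset α) (f g : α → α) : Prop :=
  ∀ U ⊆ V, U.Nonempty → (∀ x ∈ U, f x ∈ U) → (∀ x ∈ U, g x ∈ U) → U = V

theorem sign_sub_of_lt {x y : ℤ} (h : x < y) : Int.sign (x - y) = -1 :=
  Int.sign_eq_neg_one_of_neg (by omega)

theorem sign_sub_of_gt {x y : ℤ} (h : y < x) : Int.sign (x - y) = 1 :=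
  Int.sign_eq_one_of_pos (by omega)

section Meander

variable {α : Type*} [DecidableEq α]

/-- Replacing the arcs `{i, p}` and `{j, q}` of a matching by the arc `{p, q}`. -/
def reconnect (g : α → α) (p q x : α) : α :=
  if x = p then q else if x = q then p else g x

theorem IsNCMatching.erase {k : α → ℤ} {V : Finset α} {f : α → α} (hf : IsNCMatching k V f)
    {i : α} (hi : i ∈ V) : IsNCMatching k ((V.erase i).erase (f i)) f where
  mem x hx := by
    simp only [Finset.mem_erase] at hx ⊢
    refine ⟨fun h => hx.2.1 ?_, fun h => hx.1 ?_, hf.mem x hx.2.2⟩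
    · rw [← hf.invol x hx.2.2, h, hf.invol i hi]
    · rw [← h, hf.invol x hx.2.2]
  invol x hx := hf.invol x (Finset.mem_of_mem_erase (Finset.mem_of_mem_erase hx))
  ne x hx := hf.ne x (Finset.mem_of_mem_erase (Finset.mem_of_mem_erase hx))
  nc x hx u hu := hf.nc x (Finset.mem_of_mem_erase (Finset.mem_of_mem_erase hx)) u
    (Finset.mem_of_mem_erase (Finset.mem_of_mem_erase hu))

theorem IsNCMatching.reconnect {k : α → ℤ} {V : Finset α} {g : α → α}
    (hg : IsNCMatching k V g) {i j : α} (hi : i ∈ V) (hj : j ∈ V) (hij : i ≠ j) (hgi : g i ≠ j)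
    (hadj : ∀ u ∈ V, u ≠ i → u ≠ j → (k i < k u ↔ k j < k u))
    (hadj' : ∀ u ∈ V, u ≠ i → u ≠ j → (k u < k i ↔ k u < k j)) :
    IsNCMatching k ((V.erase i).erase j) (reconnect g (g i) (g j)) := by
  have hgj : g j ≠ i := fun h => hgi (by rw [← h, hg.invol j hj])
  have hpq : g i ≠ g j := fun h => hij (by rw [← hg.invol i hi, h, hg.invol j hj])
  have hi' := hg.ne i hi
  have hj' := hg.ne j hj
  have hp := hg.mem i hi
  have hq := hg.mem j hj
  have off : ∀ x ∈ V, x ≠ i → x ≠ j → x ≠ g i → x ≠ g j →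
      g x ≠ i ∧ g x ≠ j ∧ g x ≠ g i ∧ g x ≠ g j := by
    intro x hx h1 h2 h3 h4
    have := hg.invol x hx
    refine ⟨fun h => h3 (by rw [← h, this]), fun h => h4 (by rw [← h, this]), fun h => h1 ?_,
      fun h => h2 ?_⟩
    · rw [← this, h, hg.invol i hi]
    · rw [← this, h, hg.invol j hj]
  have cases : ∀ x ∈ (V.erase i).erase j, x ∈ V ∧ x ≠ i ∧ x ≠ j := by
    intro x hx; simp only [Finset.mem_erase] at hx; tauto
  constructor
  · intro x hx
    obtain ⟨hx, h1, h2⟩ := cases x hx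
    simp only [BK.reconnect, Finset.mem_erase]
    split_ifs with h3 h4
    · exact ⟨hj', hgj, hq⟩
    · exact ⟨hgi, hi', hp⟩
    · have := off x hx h1 h2 h3 h4
      exact ⟨this.2.1, this.1, hg.mem x hx⟩
  · intro x hx
    obtain ⟨hx, h1, h2⟩ := cases x hx
    by_cases h3 : x = g i
    · subst h3; simp [BK.reconnect, hpq.symm]
    by_cases h4 : x = g j
    · subst h4; simp [BK.reconnect, h3]
    have := off x hx h1 h2 h3 h4
    simp [BK.reconnect, h3, h4, this, hg.invol x hx]
  · intro x hx
    obtain ⟨hx, h1, h2⟩ := cases x hx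
    simp only [BK.reconnect]
    split_ifs with h3 h4
    · rw [h3]; exact hpq.symm
    · rw [h4]; exact hpq
    · exact hg.ne x hx
  · intro x hx u hu hux hugx
    obtain ⟨hx, h1, h2⟩ := cases x hx
    obtain ⟨hu, h1', h2'⟩ := cases u hu
    by_cases h3 : x = g i
    · have h3u : u ≠ g i := h3 ▸ hux
      have h4u : u ≠ g j := by simpa [BK.reconnect, h3] using hugx
      have ho := off u hu h1' h2' h3u h4u
      have n1 := hg.nc i hi u hu h1' h3u
      have n2 := hg.nc j hj u hu h2' h4u
      have n3 := hadj u hu h1' h2'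
      have n4 := hadj (g u) (hg.mem u hu) ho.1 ho.2.1
      simp only [BK.reconnect, h3, h3u, h4u, if_true, if_false]
      grind
    by_cases h4 : x = g j
    · have h4u : u ≠ g j := h4 ▸ hux
      have h3u : u ≠ g i := by simpa [BK.reconnect, h4, hpq.symm] using hugx
      have ho := off u hu h1' h2' h3u h4u
      have n1 := hg.nc i hi u hu h1' h3u
      have n2 := hg.nc j hj u hu h2' h4u
      have n3 := hadj u hu h1' h2'
      have n4 := hadj (g u) (hg.mem u hu) ho.1 ho.2.1
      simp only [BK.reconnect, h4, h3u, h4u, hpq.symm, if_true, if_false]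
      grind
    have ho := off x hx h1 h2 h3 h4
    have n1 := hg.nc x hx i hi h1.symm ho.1.symm
    have n2 := hg.nc x hx j hj h2.symm ho.2.1.symm
    have n3 := hadj' x hx h1 h2
    have n4 := hadj' (g x) (hg.mem x hx) ho.1 ho.2.1
    have n5 : u ≠ g x → _ := hg.nc x hx u hu hux
    simp only [BK.reconnect, h3, h4, if_false] at hugx ⊢
    split_ifs with h5 h6
    · subst h5; grind
    · subst h6; grind
    · exact n5 hugx

theorem IsSingleOrbit.reconnect {V : Finset α} {f g : α → α} {i : α} (hi : i ∈ V)
    (hf : ∀ x ∈ V, f (f x) = x) (hg : ∀ x ∈ V, g (g x) = x) (hgV : ∀ x ∈ V, g x ∈ V)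
    (hfi : f i ∈ V) (hgi : g i ≠ f i) (hgi' : g i ≠ i)
    (hconn : IsSingleOrbit V f g) :
    IsSingleOrbit ((V.erase i).erase (f i)) f (reconnect g (g i) (g (f i))) := by
  intro U hUV hU hUf hUg
  have hmem : ∀ x ∈ U, x ≠ f i ∧ x ≠ i ∧ x ∈ V := fun x hx => by simpa using hUV hx
  have hpU : g i ∈ U ↔ g (f i) ∈ U := by
    constructor
    · intro h; have := hUg _ h; simpa [BK.reconnect] using this
    · intro h
      by_cases hc : g (f i) = g i
      · rwa [← hc]
      have := hUg _ h; simpa [BK.reconnect, hc] using this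
  by_cases hp : g i ∈ U
  · have key := hconn (insert i (insert (f i) U)) (by
      intro x hx
      simp only [Finset.mem_insert] at hx
      rcases hx with rfl | rfl | hx
      exacts [hi, hfi, (hmem x hx).2.2]) ⟨i, by simp⟩ (by
      intro x hx
      simp only [Finset.mem_insert] at hx ⊢
      rcases hx with rfl | rfl | hx
      · simp
      · left; exact hf i hi
      · right; right; exact hUf x hx) (by
      intro x hx
      simp only [Finset.mem_insert] at hx ⊢
      rcases hx with rfl | rfl | hx
      · simp [hp]
      · simp [hpU.1 hp]
      · by_cases h3 : x = g i
        · left; rw [h3, hg i hi]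
        by_cases h4 : x = g (f i)
        · right; left; rw [h4, hg _ hfi]
        have := hUg x hx
        simp only [BK.reconnect, h3, h4, if_false] at this
        simp [this])
    ext x
    rw [← key]
    simp only [Finset.mem_erase, Finset.mem_insert]
    constructor
    · intro h; exact ⟨(hmem x h).1, (hmem x h).2.1, by simp [h]⟩
    · tauto
  · exfalso
    have key := hconn U (fun x hx => (hmem x hx).2.2) hU hUf (by
      intro x hx
      have h3 : x ≠ g i := fun h => hp (h ▸ hx)
      have h4 : x ≠ g (f i) := fun h => hp (hpU.2 (h ▸ hx))
      have := hUg x hx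
      simpa only [BK.reconnect, h3, h4, if_false] using this)
    exact hp (key ▸ hgV i hi)

/-- Turning number of a simple closed meander: the signed number of its arcs (each counted at
both of its ends) is `±4`, the sign being the label of the last point. -/
theorem meander_turning (k : α → ℤ) (ε : α → ℤ) (m : α) (n : ℕ) :
    ∀ (V : Finset α) (f g : α → α), V.card = n → (∀ x ∈ V, ∀ y ∈ V, k x = k y → x = y) →
    IsNCMatching k V f → IsNCMatching k V g → IsSingleOrbit V f g →
    (∀ x ∈ V, ε (f x) = -ε x) → (∀ x ∈ V, ε (g x) = -ε x) →
    m ∈ V → (∀ x ∈ V, k x ≤ k m) →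
    ∑ x ∈ V, ε x * (Int.sign (k x - k (f x)) + Int.sign (k x - k (g x))) = 4 * ε m := by
  induction n using Nat.strong_induction_on with
  | _ n ih =>
  intro V f g hn hk hf hg hconn hεf hεg hm hmax
  have hlt : ∀ x ∈ V, ∀ y ∈ V, x ≠ y → k x ≠ k y := fun x hx y hy hxy h => hxy (hk x hx y hy h)
  by_cases hex : ∃ i ∈ V, k i < k (f i) ∧ f i ≠ m
  · obtain ⟨i, hi, hmin⟩ := Finset.exists_min_image
      (V.filter fun i => k i < k (f i) ∧ f i ≠ m) (fun i => k (f i) - k i)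
      (by obtain ⟨i, hi, h⟩ := hex; exact ⟨i, by simp [hi, h]⟩)
    simp only [Finset.mem_filter, and_imp] at hi hmin
    obtain ⟨hi, hilt, hfim⟩ := hi
    set j := f i with hj_def
    have hj : j ∈ V := hf.mem i hi
    have hij : i ≠ j := (hf.ne i hi).symm
    have him : i ≠ m := fun h => by have := hmax j hj; rw [← h] at this; omega
    have hfj : f j = i := hf.invol i hi
    have hinner : ∀ u ∈ V, ¬ (k i < k u ∧ k u < k j) := by
      rintro u hu ⟨h1, h2⟩
      have hui : u ≠ i := fun h => by subst h; omega
      have huj : u ≠ j := fun h => by subst h; omega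
      have h3 := hf.nc i hi u hu hui huj
      rw [← hj_def] at h3
      have hfu := hf.mem u hu
      have hne := hlt _ hfu _ hu (hf.ne u hu)
      have hfui : f u ≠ i := fun h => huj (by rw [hj_def, ← h, hf.invol u hu])
      have hfuj : f u ≠ j := fun h => hui (by rw [← hf.invol u hu, h, hfj])
      have h4 := hlt _ hfu _ hi hfui
      have h5 := hlt _ hfu _ hj hfuj
      have hjm := hmax j hj
      have hum : u ≠ m := fun h => by subst h; omega
      have hfum : f u ≠ m := fun h => by rw [← h] at hjm; omega
      rcases lt_or_gt_of_ne hne with h | h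
      · have := hmin (f u) hfu (by rw [hf.invol u hu]; exact h) (by rw [hf.invol u hu]; exact hum)
        rw [hf.invol u hu] at this
        omega
      · have := hmin u hu h hfum
        omega
    have hadj : ∀ u ∈ V, u ≠ i → u ≠ j → (k i < k u ↔ k j < k u) := by
      intro u hu h1 h2
      have := hinner u hu
      have := hlt u hu i hi h1
      have := hlt u hu j hj h2
      omega
    have hadj' : ∀ u ∈ V, u ≠ i → u ≠ j → (k u < k i ↔ k u < k j) := by
      intro u hu h1 h2
      have := hinner u hu
      have := hlt u hu i hi h1
      have := hlt u hu j hj h2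
      omega
    have hgi : g i ≠ j := by
      intro h
      have hgj : g j = i := by rw [← h, hg.invol i hi]
      have := hconn {i, j} (by intro x hx; simp at hx; rcases hx with rfl | rfl <;> assumption)
        ⟨i, by simp⟩ (by simp [hfj, ← hj_def]) (by simp [h, hgj])
      rw [← this] at hm
      simp at hm
      rcases hm with h | h
      · exact him h.symm
      · exact hfim h.symm
    have hgj : g j ≠ i := fun h => hgi (by rw [← h, hg.invol j hj])
    have hp := hg.mem i hi
    have hq := hg.mem j hj
    have hpi := hg.ne i hi
    have hqj := hg.ne j hj
    have hpq : g i ≠ g j := fun h => hij (by rw [← hg.invol i hi, h, hg.invol j hj])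
    have hsub : (V.erase i).erase j ⊆ V :=
      (Finset.erase_subset _ _).trans (Finset.erase_subset _ _)
    have hpV : g i ∈ (V.erase i).erase j := by simp [hp, hpi, hgi]
    have hqV : g j ∈ ((V.erase i).erase j).erase (g i) := by simp [hq, hqj, hgj, hpq.symm]
    have hjV : j ∈ V.erase i := by simp [hj, hij.symm]
    have IH := ih ((V.erase i).erase j).card
      (by rw [← hn]; exact Finset.card_lt_card
            (Finset.ssubset_of_subset_of_ssubset (Finset.erase_subset _ _)
              (Finset.erase_ssubset hi)))
      ((V.erase i).erase j) f (reconnect g (g i) (g j)) rfl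
      (fun x hx y hy => hk x (hsub hx) y (hsub hy))
      (hf.erase hi) (hg.reconnect hi hj hij hgi hadj hadj')
      (hconn.reconnect hi hf.invol hg.invol hg.mem hj hgi hpi)
      (fun x hx => hεf x (hsub hx))
      (by
        intro x hx
        simp only [reconnect]
        split_ifs with h1 h2
        · rw [h1, hεg i hi, hεg j hj, hj_def, hεf i hi]
        · rw [h2, hεg i hi, hεg j hj, hj_def, hεf i hi]; ring
        · exact hεg x (hsub hx))
      (by simp [hm, him.symm, Ne.symm hfim]) (fun x hx => hmax x (hsub hx))
    rw [← IH, ← Finset.add_sum_erase V _ hi, ← Finset.add_sum_erase _ _ hjV,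
      ← Finset.add_sum_erase _ _ hpV, ← Finset.add_sum_erase _ _ hqV,
      ← Finset.add_sum_erase _ (fun x => ε x * (Int.sign (k x - k (f x)) +
        Int.sign (k x - k (reconnect g (g i) (g j) x)))) hpV,
      ← Finset.add_sum_erase _ (fun x => ε x * (Int.sign (k x - k (f x)) +
        Int.sign (k x - k (reconnect g (g i) (g j) x)))) hqV]
    have hrest : ∑ x ∈ (((V.erase i).erase j).erase (g i)).erase (g j),
        ε x * (Int.sign (k x - k (f x)) + Int.sign (k x - k (reconnect g (g i) (g j) x))) =
        ∑ x ∈ (((V.erase i).erase j).erase (g i)).erase (g j),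
        ε x * (Int.sign (k x - k (f x)) + Int.sign (k x - k (g x))) := by
      refine Finset.sum_congr rfl fun x hx => ?_
      simp only [Finset.mem_erase] at hx
      simp [reconnect, hx.1, hx.2.1]
    rw [hrest]
    have e1 : ε j = -ε i := hεf i hi
    have e2 : ε (g i) = -ε i := hεg i hi
    have e3 : ε (g j) = ε i := by rw [hεg j hj, e1, neg_neg]
    have r1 : reconnect g (g i) (g j) (g i) = g j := by simp [reconnect]
    have r2 : reconnect g (g i) (g j) (g j) = g i := by simp [reconnect, hpq.symm]
    have n1 := hg.nc i hi j hj hij.symm hgi.symm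
    have n2 := hadj (g i) hp hpi hgi
    have n3 := hadj (g j) hq hgj hqj
    have n4 := hlt _ hp _ hi hpi
    have n5 := hlt _ hp _ hj hgi
    have n6 := hlt _ hq _ hi hgj
    have n7 := hlt _ hq _ hj hqj
    have n8 := hlt _ hp _ hq hpq
    rw [r1, r2, e1, e2, e3, hg.invol i hi, hg.invol j hj, hfj, ← hj_def, sign_sub_of_lt hilt,
      sign_sub_of_gt hilt]
    rcases lt_or_gt_of_ne n4 with h4 | h4 <;> rcases lt_or_gt_of_ne n7 with h7 | h7 <;>
      rcases lt_or_gt_of_ne n8 with h8 | h8 <;>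
      first
      | (exfalso; omega)
      | (simp only [sign_sub_of_lt, sign_sub_of_gt, h4, h7, h8]; ring)
  · push Not at hex
    have hVm : ∀ x ∈ V, x = m ∨ x = f m := by
      intro x hx
      have hfx := hf.mem x hx
      rcases lt_or_gt_of_ne (hlt _ hfx _ hx (hf.ne x hx)) with h | h
      · left
        have := hex (f x) hfx (by rw [hf.invol x hx]; exact h)
        rwa [hf.invol x hx] at this
      · right
        rw [← hex x hx h, hf.invol x hx]
    have hfm := hf.mem m hm
    have hne := hf.ne m hm
    have hgm : g m = f m := by
      rcases hVm _ (hg.mem m hm) with h | h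
      · exact absurd h (hg.ne m hm)
      · exact h
    have hgfm : g (f m) = m := by rw [← hgm, hg.invol m hm]
    have hV : V = {m, f m} := by
      ext x
      simp only [Finset.mem_insert, Finset.mem_singleton]
      exact ⟨hVm x, by rintro (rfl | rfl) <;> assumption⟩
    have hlt' : k (f m) < k m := lt_of_le_of_ne (hmax _ hfm) (hlt _ hfm _ hm hne)
    rw [hV, Finset.sum_pair hne.symm, hgm, hgfm, hf.invol m hm, hεf m hm, sign_sub_of_lt hlt',
      sign_sub_of_gt hlt']
    ring

end Meander

section Stack

/-- The other end of the outer arc (bottom cup or top cap) at a point. -/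
def outer (a e : ℤ → ℤ) (x : Pt) : Pt :=
  if x.2 then (e x.1, true) else (a x.1, false)

/-- The other end of the middle arc at a point: a vertical segment over `W`, and an arc of `d`
elsewhere. -/
noncomputable def inner (d : ℤ → ℤ) (W : Set ℤ) (x : Pt) : Pt :=
  if x.1 ∈ W then (x.1, !x.2) else (d x.1, x.2)

/-- The contribution of a point to the signed count of the arcs of a stacked diagram. -/
noncomputable def turn (a e d : ℤ → ℤ) (W : Set ℤ) (ε : Pt → ℤ) (x : Pt) : ℤ :=
  ε x * (Int.sign (x.1 - (outer a e x).1) + Int.sign (x.1 - (inner d W x).1))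

/-- The combinatorial data of a stacked circle diagram: three noncrossing matchings and a set
`W` of vertical segments, none of which is separated by a remaining middle arc. -/
structure IsStack (V : Finset ℤ) (a e d : ℤ → ℤ) (W : Set ℤ) : Prop where
  bot : IsNCMatching id V a
  top : IsNCMatching id V e
  mid : IsNCMatching id V d
  vert : ∀ v ∈ V, (d v ∈ W ↔ v ∈ W)
  vert_nc : ∀ v ∈ V, v ∉ W → ∀ w ∈ V, w ∈ W → (v < w ↔ d v < w)

/-- `S` is a circle of the stacked diagram. -/
structure IsStackCircle (V : Finset ℤ) (a e d : ℤ → ℤ) (W : Set ℤ) (S : Finset Pt) : Prop where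
  mem : ∀ x ∈ S, x.1 ∈ V
  outer_mem : ∀ x ∈ S, outer a e x ∈ S
  inner_mem : ∀ x ∈ S, inner d W x ∈ S
  conn : IsSingleOrbit S (outer a e) (inner d W)

/-- `ε` orients the arcs of the stacked diagram at the points of `S`. -/
structure IsStackSign (a e d : ℤ → ℤ) (W : Set ℤ) (S : Finset Pt) (ε : Pt → ℤ) : Prop where
  outer : ∀ x ∈ S, ε (outer a e x) = -ε x
  inner : ∀ x ∈ S, ε (inner d W x) = if x.1 ∈ W then ε x else -ε x

/-- The line crossed by a stacked diagram: along the bottom row, back through the middle, and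
along the top row. -/
def rowKey (M : ℤ) : Pt ⊕ ℤ → ℤ :=
  Sum.elim (fun x => if x.2 then x.1 + 3 * M else x.1 - 3 * M) (fun v => -v)

/-- The arcs on one side of the line: the outer arcs `c` of the row `!b` and the middle arcs at
the row `b`. The right hand side is given by `b = true`, the left hand side by `b = false`. -/
noncomputable def sideArc (c d : ℤ → ℤ) (W : Set ℤ) (b : Bool) : Pt ⊕ ℤ → Pt ⊕ ℤ :=
  Sum.elim (fun x => if x.2 = b then (if x.1 ∈ W then Sum.inr x.1 else Sum.inl (d x.1, b))
    else Sum.inl (c x.1, !b)) (fun v => Sum.inl (v, b))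

/-- The points of `S` together with the crossings of its vertical segments with the middle part
of the line. -/
noncomputable def crossings (W : Set ℤ) (S : Finset Pt) : Finset (Pt ⊕ ℤ) :=
  S.disjSum ((S.filter fun x => x.1 ∈ W).image Prod.fst)

/-- The orientation of the crossings with the line. -/
def crossSign (ε : Pt → ℤ) : Pt ⊕ ℤ → ℤ := Sum.elim ε (fun v => -ε (v, true))

theorem inl_mem_crossings {W : Set ℤ} {S : Finset Pt} {x : Pt} :
    Sum.inl x ∈ crossings W S ↔ x ∈ S := by simp [crossings]

variable {V : Finset ℤ} {a e d : ℤ → ℤ} {W : Set ℤ} {S : Finset Pt} {ε : Pt → ℤ}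

theorem IsStackCircle.inr_mem (hS : IsStackCircle V a e d W S) {v : ℤ} :
    Sum.inr v ∈ crossings W S ↔ v ∈ W ∧ (v, true) ∈ S ∧ (v, false) ∈ S := by
  simp only [crossings, Finset.inr_mem_disjSum, Finset.mem_image, Finset.mem_filter]
  constructor
  · rintro ⟨⟨w, b⟩, ⟨h1, h2⟩, rfl⟩
    have := hS.inner_mem _ h1
    simp only [inner, if_pos h2] at this
    cases b <;> simp_all
  · rintro ⟨h1, h2, h3⟩
    exact ⟨(v, true), ⟨h2, h1⟩, rfl⟩

theorem IsStackCircle.bot_mem (hS : IsStackCircle V a e d W S) {v : ℤ} (h : (v, false) ∈ S) :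
    (a v, false) ∈ S := by simpa [outer] using hS.outer_mem _ h

theorem IsStackCircle.top_mem (hS : IsStackCircle V a e d W S) {v : ℤ} (h : (v, true) ∈ S) :
    (e v, true) ∈ S := by simpa [outer] using hS.outer_mem _ h

theorem IsStackCircle.mid_mem (hS : IsStackCircle V a e d W S) {v : ℤ} {b : Bool}
    (h : (v, b) ∈ S) (hv : v ∉ W) : (d v, b) ∈ S := by
  simpa [inner, hv] using hS.inner_mem _ h

theorem IsStackCircle.vert_mem (hS : IsStackCircle V a e d W S) {v : ℤ} {b : Bool}
    (h : (v, b) ∈ S) (hv : v ∈ W) : (v, !b) ∈ S := by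
  simpa [inner, hv] using hS.inner_mem _ h

theorem isNCMatching_sideArc (hV : IsStack V a e d W) (hS : IsStackCircle V a e d W S) {M : ℤ}
    (hM : ∀ x ∈ S, -M < x.1 ∧ x.1 < M) {c : ℤ → ℤ} (b : Bool) (hc : IsNCMatching id V c)
    (hcS : ∀ v, (v, !b) ∈ S → (c v, !b) ∈ S) :
    IsNCMatching (rowKey M) (crossings W S) (sideArc c d W b) := by
  have key : ∀ x ∈ crossings W S,
      (∃ v, (v, !b) ∈ S ∧ (c v, !b) ∈ S ∧ x = Sum.inl (v, !b) ∧
        sideArc c d W b x = Sum.inl (c v, !b)) ∨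
      (∃ v, (v, b) ∈ S ∧ v ∈ W ∧ x = Sum.inl (v, b) ∧ sideArc c d W b x = Sum.inr v) ∨
      (∃ v, (v, b) ∈ S ∧ (d v, b) ∈ S ∧ v ∉ W ∧ x = Sum.inl (v, b) ∧
        sideArc c d W b x = Sum.inl (d v, b)) ∨
      (∃ v, (v, b) ∈ S ∧ v ∈ W ∧ x = Sum.inr v ∧ sideArc c d W b x = Sum.inl (v, b)) := by
    rintro (⟨v, b'⟩ | v) hx
    · rw [inl_mem_crossings] at hx
      by_cases hb : b' = b
      · subst hb
        by_cases hv : v ∈ W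
        · exact Or.inr (Or.inl ⟨v, hx, hv, rfl, by simp [sideArc, hv]⟩)
        · exact Or.inr (Or.inr (Or.inl ⟨v, hx, hS.mid_mem hx hv, hv, rfl, by simp [sideArc, hv]⟩))
      · obtain rfl : b' = !b := by cases b <;> cases b' <;> simp_all
        exact Or.inl ⟨v, hx, hcS v hx, rfl, by simp [sideArc]⟩
    · rw [hS.inr_mem] at hx
      exact Or.inr (Or.inr (Or.inr ⟨v, by cases b <;> simp [hx], hx.1, rfl, by simp [sideArc]⟩))
  constructor
  · intro x hx
    rcases key x hx with ⟨v, -, h2, -, hr⟩ | ⟨v, h1, h2, -, hr⟩ | ⟨v, -, h2, -, -, hr⟩ |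
      ⟨v, h1, -, -, hr⟩ <;> rw [hr]
    · exact inl_mem_crossings.2 h2
    · have := hS.vert_mem h1 h2
      exact hS.inr_mem.2 (by cases b <;> simp_all)
    · exact inl_mem_crossings.2 h2
    · exact inl_mem_crossings.2 h1
  · intro x hx
    rcases key x hx with ⟨v, h1, -, rfl, hr⟩ | ⟨v, -, -, rfl, hr⟩ | ⟨v, h1, -, h3, rfl, hr⟩ |
      ⟨v, -, h2, rfl, hr⟩ <;> rw [hr]
    · simpa [sideArc] using hc.invol v (hS.mem _ h1)
    · simp [sideArc]
    · simpa [sideArc, h3, hV.vert v (hS.mem _ h1)] using hV.mid.invol v (hS.mem _ h1)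
    · simp [sideArc, h2]
  · intro x hx
    rcases key x hx with ⟨v, h1, -, rfl, hr⟩ | ⟨v, -, -, rfl, hr⟩ | ⟨v, h1, -, -, rfl, hr⟩ |
      ⟨v, -, -, rfl, hr⟩ <;> rw [hr]
    · simpa using hc.ne v (hS.mem _ h1)
    · simp
    · simpa using hV.mid.ne v (hS.mem _ h1)
    · simp
  · intro x hx u hu hux huf
    rcases key x hx with ⟨v, h1, h2, hxv, hr⟩ | ⟨v, h1, h2, hxv, hr⟩ | ⟨v, h1, h2, h3, hxv, hr⟩ |
        ⟨v, h1, h2, hxv, hr⟩ <;>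
      rcases key u hu with ⟨w, h1', h2', huw, hr'⟩ | ⟨w, h1', h2', huw, hr'⟩ |
        ⟨w, h1', h2', h3', huw, hr'⟩ | ⟨w, h1', h2', huw, hr'⟩ <;>
      rw [hr] at huf ⊢ <;> rw [hr'] <;> subst hxv <;> subst huw <;>
      simp only [rowKey, Sum.elim_inl, Sum.elim_inr, ne_eq, Sum.inl.injEq,
        Prod.mk.injEq, Sum.inr.injEq, and_true, Bool.not_eq_eq_eq_not, reduceCtorEq,
        not_false_eq_true] at hux huf ⊢ <;>
      have b1 := hM _ h1 <;> have b2 := hM _ h1' <;> simp only at b1 b2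
    · have := hc.nc v (hS.mem _ h1) w (hS.mem _ h1') hux huf
      simp only [id] at this
      cases b <;> simp <;> omega
    · have := hM _ h2; cases b <;> simp at * <;> omega
    · have := hM _ h2; have := hM _ h2'; cases b <;> simp at * <;> omega
    · have := hM _ h2; cases b <;> simp at * <;> omega
    · have := hM _ h2'; cases b <;> simp at * <;> omega
    · cases b <;> simp <;> omega
    · have := hV.vert_nc w (hS.mem _ h1') h3' v (hS.mem _ h1) h2
      have := hM _ h2'
      have : v ≠ d w := fun h => h3' ((hV.vert w (hS.mem _ h1')).1 (h ▸ h2))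
      cases b <;> simp at * <;> omega
    · cases b <;> simp <;> omega
    · have := hM _ h2; have := hM _ h2'; cases b <;> simp at * <;> omega
    · have := hV.vert_nc v (hS.mem _ h1) h3 w (hS.mem _ h1') h2'
      have := hM _ h2
      cases b <;> simp at * <;> omega
    · have := hV.mid.nc v (hS.mem _ h1) w (hS.mem _ h1') hux huf
      simp only [id] at this
      cases b <;> simp <;> omega
    · have := hV.vert_nc v (hS.mem _ h1) h3 w (hS.mem _ h1') h2'
      have := hM _ h2
      cases b <;> simp at * <;> omega
    · have := hM _ h2'; cases b <;> simp at * <;> omega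
    · cases b <;> simp <;> omega
    · have := hV.vert_nc w (hS.mem _ h1') h3' v (hS.mem _ h1) h2
      have := hM _ h2'
      have : v ≠ d w := fun h => h3' ((hV.vert w (hS.mem _ h1')).1 (h ▸ h2))
      cases b <;> simp at * <;> omega
    · cases b <;> simp <;> omega

theorem isSingleOrbit_crossings (hS : IsStackCircle V a e d W S) :
    IsSingleOrbit (crossings W S) (sideArc a d W true) (sideArc e d W false) := by
  intro U hUS hU hr hl
  have hvt : ∀ v, v ∈ W → Sum.inl (v, true) ∈ U → Sum.inr v ∈ U := fun v hv h => by
    simpa [sideArc, hv] using hr _ h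
  have hvf : ∀ v, v ∈ W → Sum.inl (v, false) ∈ U → Sum.inr v ∈ U := fun v hv h => by
    simpa [sideArc, hv] using hl _ h
  have hmt : ∀ v, Sum.inr v ∈ U → Sum.inl (v, true) ∈ U := fun v h => by
    simpa [sideArc] using hr _ h
  have hmf : ∀ v, Sum.inr v ∈ U → Sum.inl (v, false) ∈ U := fun v h => by
    simpa [sideArc] using hl _ h
  have key := hS.conn (S.filter fun x => Sum.inl x ∈ U) (Finset.filter_subset _ _) (by
      obtain ⟨x | v, hx⟩ := hU
      · exact ⟨x, by simpa [hx] using inl_mem_crossings.1 (hUS hx)⟩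
      · have := hmt v hx
        exact ⟨(v, true), by simpa [this] using inl_mem_crossings.1 (hUS this)⟩) (by
      rintro ⟨v, b⟩ hx
      simp only [Finset.mem_filter] at hx ⊢
      refine ⟨hS.outer_mem _ hx.1, ?_⟩
      cases b
      · simpa [sideArc, outer] using hr _ hx.2
      · simpa [sideArc, outer] using hl _ hx.2) (by
      rintro ⟨v, b⟩ hx
      simp only [Finset.mem_filter] at hx ⊢
      refine ⟨hS.inner_mem _ hx.1, ?_⟩
      by_cases hv : v ∈ W
      · cases b
        · simpa [inner, hv] using hmt v (hvf v hv hx.2)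
        · simpa [inner, hv] using hmf v (hvt v hv hx.2)
      · cases b
        · simpa [sideArc, inner, hv] using hl _ hx.2
        · simpa [sideArc, inner, hv] using hr _ hx.2)
  have hall : ∀ x ∈ S, Sum.inl x ∈ U := fun x hx => by
    rw [← key] at hx
    exact (Finset.mem_filter.1 hx).2
  refine Finset.Subset.antisymm hUS ?_
  rintro (x | v) hx
  · exact hall x (inl_mem_crossings.1 hx)
  · rw [hS.inr_mem] at hx
    exact hvt v hx.1 (hall _ hx.2.1)

theorem crossSign_sideArc (hS : IsStackCircle V a e d W S) (hε : IsStackSign a e d W S ε) :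
    (∀ x ∈ crossings W S, crossSign ε (sideArc a d W true x) = -crossSign ε x) ∧
    (∀ x ∈ crossings W S, crossSign ε (sideArc e d W false x) = -crossSign ε x) := by
  have hvert : ∀ v ∈ W, (v, false) ∈ S → ε (v, true) = ε (v, false) := fun v hv h => by
    simpa [inner, hv] using hε.inner _ h
  constructor <;> rintro (⟨v, b⟩ | v) hx
  · rw [inl_mem_crossings] at hx
    cases b
    · simpa [sideArc, crossSign, outer] using hε.outer _ hx
    · by_cases hv : v ∈ W
      · simp [sideArc, crossSign, hv]
      · simpa [sideArc, crossSign, hv, inner] using hε.inner _ hx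
  · simp [sideArc, crossSign]
  · rw [inl_mem_crossings] at hx
    cases b
    · by_cases hv : v ∈ W
      · simp [sideArc, crossSign, hv, hvert v hv hx]
      · simpa [sideArc, crossSign, hv, inner] using hε.inner _ hx
    · simpa [sideArc, crossSign, outer] using hε.outer _ hx
  · rw [hS.inr_mem] at hx
    simp [sideArc, crossSign, hvert v hx.1 hx.2.2]

theorem sum_vertical_eq_zero (hS : IsStackCircle V a e d W S) (hε : IsStackSign a e d W S ε) :
    ∑ x ∈ S, (if x.1 ∈ W then ε x * (if x.2 then 1 else -1) else 0) = 0 := by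
  rw [← Finset.sum_filter]
  refine Finset.sum_involution (fun x _ => (x.1, !x.2)) ?_ ?_ ?_ ?_
  · rintro ⟨v, b⟩ hx
    rw [Finset.mem_filter] at hx
    have : ε (v, !b) = ε (v, b) := by simpa [inner, hx.2] using hε.inner _ hx.1
    cases b <;> simp_all
  · rintro ⟨v, b⟩ hx _
    simp
  · rintro ⟨v, b⟩ hx
    rw [Finset.mem_filter] at hx ⊢
    exact ⟨hS.vert_mem hx.1 hx.2, hx.2⟩
  · rintro ⟨v, b⟩ hx
    simp

theorem exists_bound (S : Finset Pt) : ∃ M : ℤ, ∀ x ∈ S, -M < x.1 ∧ x.1 < M := by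
  refine ⟨∑ x ∈ S, |x.1| + 1, fun x hx => ?_⟩
  have := Finset.single_le_sum (f := fun x : Pt => |x.1|) (fun _ _ => abs_nonneg _) hx
  have := abs_le.1 this
  omega

theorem rowKey_injOn {M : ℤ} (hS : IsStackCircle V a e d W S)
    (hM : ∀ x ∈ S, -M < x.1 ∧ x.1 < M) :
    ∀ x ∈ crossings W S, ∀ y ∈ crossings W S, rowKey M x = rowKey M y → x = y := by
  rintro (⟨v, b⟩ | v) hx (⟨w, b'⟩ | w) hy h
  · rw [inl_mem_crossings] at hx hy
    have := hM _ hx; have := hM _ hy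
    cases b <;> cases b' <;> simp [rowKey] at * <;> omega
  · rw [inl_mem_crossings] at hx
    have := hM _ hx; have := hM _ (hS.inr_mem.1 hy).2.1
    cases b <;> simp [rowKey] at * <;> omega
  · rw [inl_mem_crossings] at hy
    have := hM _ hy; have := hM _ (hS.inr_mem.1 hx).2.1
    cases b' <;> simp [rowKey] at * <;> omega
  · simp [rowKey] at *; exact h

theorem circle_turning_top (hV : IsStack V a e d W) (hS : IsStackCircle V a e d W S)
    (hε : IsStackSign a e d W S ε) {v : ℤ} (hv : (v, true) ∈ S) (hmax : ∀ x ∈ S, x.1 ≤ v) :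
    ∑ x ∈ S, turn a e d W ε x = 4 * ε (v, true) := by
  obtain ⟨M, hM⟩ := exists_bound S
  have key := meander_turning (rowKey M) (crossSign ε) (Sum.inl (v, true)) _ (crossings W S)
    (sideArc a d W true) (sideArc e d W false) rfl (rowKey_injOn hS hM)
    (isNCMatching_sideArc hV hS hM true hV.bot fun _ h => hS.bot_mem h)
    (isNCMatching_sideArc hV hS hM false hV.top fun _ h => hS.top_mem h)
    (isSingleOrbit_crossings hS) (crossSign_sideArc hS hε).1 (crossSign_sideArc hS hε).2
    (inl_mem_crossings.2 hv) (by
      have := hM _ hv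
      rintro (⟨w, b⟩ | w) hx
      · rw [inl_mem_crossings] at hx
        have := hM _ hx; have := hmax _ hx
        cases b <;> simp [rowKey] at * <;> omega
      · have := hM _ (hS.inr_mem.1 hx).2.1
        simp [rowKey] at *; omega)
  have hsum := sum_vertical_eq_zero hS hε
  rw [crossings, Finset.sum_disjSum] at key
  have hmid : ∑ w ∈ (S.filter fun x => x.1 ∈ W).image Prod.fst, crossSign ε (Sum.inr w) *
      (Int.sign (rowKey M (Sum.inr w) - rowKey M (sideArc a d W true (Sum.inr w))) +
        Int.sign (rowKey M (Sum.inr w) - rowKey M (sideArc e d W false (Sum.inr w)))) = 0 := by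
    refine Finset.sum_eq_zero fun w hw => ?_
    obtain ⟨x, hx, rfl⟩ := Finset.mem_image.1 hw
    have := hM x (Finset.mem_filter.1 hx).1
    have h1 : -x.1 < x.1 + 3 * M := by omega
    have h2 : x.1 - 3 * M < -x.1 := by omega
    simp only [rowKey, sideArc, Sum.elim_inl, Sum.elim_inr, if_true, Bool.false_eq_true, if_false,
      sign_sub_of_lt h1, sign_sub_of_gt h2]
    ring
  rw [hmid, add_zero] at key
  change _ = 4 * ε (v, true) at key
  rw [← key, ← add_zero (∑ x ∈ S, turn a e d W ε x), ← hsum, ← Finset.sum_add_distrib]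
  refine Finset.sum_congr rfl ?_
  rintro ⟨w, b⟩ hx
  have := hM _ hx
  simp only at this
  by_cases hw : w ∈ W
  · cases b
    · have h1 : w - 3 * M < -w := by omega
      simp only [turn, outer, inner, hw, crossSign, rowKey, sideArc, Sum.elim_inl, Sum.elim_inr,
        if_true, Bool.false_eq_true, if_false, sub_self, Int.sign_zero, sign_sub_of_lt h1,
        Bool.not_false, Bool.not_true, sub_sub_sub_cancel_right]
      ring
    · have h1 : -w < w + 3 * M := by omega
      simp only [turn, outer, inner, hw, crossSign, rowKey, sideArc, Sum.elim_inl, Sum.elim_inr,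
        if_true, Bool.true_eq_false, if_false, sub_self, Int.sign_zero, sign_sub_of_gt h1,
        Bool.not_false, add_sub_add_right_eq_sub]
      ring
  · cases b
    · simp [turn, outer, inner, hw, crossSign, rowKey, sideArc]
    · simp [turn, outer, inner, hw, crossSign, rowKey, sideArc]
      left; ring

/-- Exchanging the two rows of a stacked diagram. -/
def flipRow (x : Pt) : Pt := (x.1, !x.2)

theorem flipRow_flipRow (x : Pt) : flipRow (flipRow x) = x := by simp [flipRow]

theorem flipRow_injective : Function.Injective flipRow :=
  Function.LeftInverse.injective flipRow_flipRow

theorem flipRow_outer (x : Pt) : flipRow (outer a e x) = outer e a (flipRow x) := by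
  rcases x with ⟨v, _ | _⟩ <;> simp [flipRow, outer]

theorem flipRow_inner (x : Pt) : flipRow (inner d W x) = inner d W (flipRow x) := by
  rcases x with ⟨v, b⟩
  by_cases hv : v ∈ W <;> simp [flipRow, inner, hv]

theorem IsStack.flip (hV : IsStack V a e d W) : IsStack V e a d W :=
  ⟨hV.top, hV.bot, hV.mid, hV.vert, hV.vert_nc⟩

theorem IsStackCircle.flip (hS : IsStackCircle V a e d W S) :
    IsStackCircle V e a d W (S.image flipRow) where
  mem x hx := by
    obtain ⟨y, hy, rfl⟩ := Finset.mem_image.1 hx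
    exact hS.mem y hy
  outer_mem x hx := by
    obtain ⟨y, hy, rfl⟩ := Finset.mem_image.1 hx
    rw [← flipRow_outer]
    exact Finset.mem_image_of_mem _ (hS.outer_mem y hy)
  inner_mem x hx := by
    obtain ⟨y, hy, rfl⟩ := Finset.mem_image.1 hx
    rw [← flipRow_inner]
    exact Finset.mem_image_of_mem _ (hS.inner_mem y hy)
  conn U hUS hU ho hi := by
    have key := hS.conn (U.image flipRow) (by
        intro x hx
        obtain ⟨y, hy, rfl⟩ := Finset.mem_image.1 hx
        obtain ⟨z, hz, rfl⟩ := Finset.mem_image.1 (hUS hy)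
        rwa [flipRow_flipRow]) (hU.image _) (by
        intro x hx
        obtain ⟨y, hy, rfl⟩ := Finset.mem_image.1 hx
        rw [← flipRow_outer]
        exact Finset.mem_image_of_mem _ (ho y hy)) (by
        intro x hx
        obtain ⟨y, hy, rfl⟩ := Finset.mem_image.1 hx
        rw [← flipRow_inner]
        exact Finset.mem_image_of_mem _ (hi y hy))
    rw [← key, Finset.image_image]
    have : flipRow ∘ flipRow = id := funext flipRow_flipRow
    rw [this, Finset.image_id]

theorem IsStackSign.flip (hε : IsStackSign a e d W S ε) :
    IsStackSign e a d W (S.image flipRow) (ε ∘ flipRow) where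
  outer x hx := by
    obtain ⟨y, hy, rfl⟩ := Finset.mem_image.1 hx
    simp only [Function.comp_apply, flipRow_outer, flipRow_flipRow]
    exact hε.outer y hy
  inner x hx := by
    obtain ⟨y, hy, rfl⟩ := Finset.mem_image.1 hx
    simp only [Function.comp_apply, flipRow_inner, flipRow_flipRow]
    exact hε.inner y hy

/-- Turning number of a circle of a stacked diagram. -/
theorem circle_turning (hV : IsStack V a e d W) (hS : IsStackCircle V a e d W S)
    (hε : IsStackSign a e d W S ε) {p : Pt} (hp : p ∈ S) (hmax : ∀ x ∈ S, x.1 ≤ p.1) :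
    ∑ x ∈ S, turn a e d W ε x = 4 * ε p := by
  obtain ⟨v, b⟩ := p
  cases b
  · have key := circle_turning_top hV.flip hS.flip hε.flip (v := v)
      (Finset.mem_image.2 ⟨_, hp, rfl⟩) (by
        intro x hx
        obtain ⟨y, hy, rfl⟩ := Finset.mem_image.1 hx
        exact hmax y hy)
    rw [Finset.sum_image fun x _ y _ h => flipRow_injective h] at key
    change _ = 4 * ε (v, false) at key
    rw [← key]
    refine Finset.sum_congr rfl fun x _ => ?_
    simp only [turn, Function.comp_apply, flipRow_flipRow, ← flipRow_outer, ← flipRow_inner]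
    rfl
  · exact circle_turning_top hV hS hε hp hmax

end Stack

section Surgery

variable {V : Finset ℤ} {a e d : ℤ → ℤ} {W : Set ℤ} {S T : Finset Pt} {ε : Pt → ℤ}

theorem even_card_of_involution {α : Type*} [DecidableEq α] (X : Finset α) (f : α → α)
    (hmem : ∀ x ∈ X, f x ∈ X) (hinv : ∀ x ∈ X, f (f x) = x) (hne : ∀ x ∈ X, f x ≠ x) :
    Even X.card := by
  have h : ∑ x ∈ X, (1 : ZMod 2) = 0 :=
    Finset.sum_involution (fun x _ => f x) (fun _ _ => by decide) (fun x hx _ => hne x hx)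
      (fun x hx => hmem x hx) (fun x hx => hinv x hx)
  rw [← ZMod.natCast_eq_zero_iff_even, ← h]
  simp

/-- The sign of a vertex given by the parity of its position in `V`. -/
def rankSign (V : Finset ℤ) (v : ℤ) : ℤ := (-1) ^ (V.filter (· < v)).card

theorem rankSign_ne_zero (v : ℤ) : rankSign V v ≠ 0 := by simp [rankSign]

theorem IsNCMatching.rankSign_of_lt {c : ℤ → ℤ} (hc : IsNCMatching id V c) {v : ℤ} (hv : v ∈ V)
    (hlt : v < c v) : rankSign V (c v) = -rankSign V v := by
  have heven : Even (V.filter fun u => v < u ∧ u < c v).card := by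
    refine even_card_of_involution _ c ?_ ?_ ?_
    · intro u hu
      simp only [Finset.mem_filter] at hu ⊢
      have hcu := hc.mem u hu.1
      have := hc.nc v hv u hu.1 (by omega) (by omega)
      have h1 : c u ≠ v := fun h => by have := hc.invol u hu.1; rw [h] at this; omega
      have h2 : c u ≠ c v := fun h => by
        have := hc.invol u hu.1; rw [h, hc.invol v hv] at this; omega
      simp only [id] at this
      refine ⟨hcu, ?_⟩
      omega
    · intro u hu; exact hc.invol u (Finset.mem_filter.1 hu).1
    · intro u hu; exact hc.ne u (Finset.mem_filter.1 hu).1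
  have hsplit : V.filter (· < c v) =
      (V.filter (· < v)) ∪ insert v (V.filter fun u => v < u ∧ u < c v) := by
    ext u
    simp only [Finset.mem_filter, Finset.mem_union, Finset.mem_insert]
    constructor
    · rintro ⟨h1, h2⟩
      rcases lt_trichotomy u v with h | h | h
      · exact Or.inl ⟨h1, h⟩
      · exact Or.inr (Or.inl h)
      · exact Or.inr (Or.inr ⟨h1, h, h2⟩)
    · rintro (⟨h1, h2⟩ | rfl | ⟨h1, h2, h3⟩)
      · exact ⟨h1, h2.trans hlt⟩
      · exact ⟨hv, hlt⟩
      · exact ⟨h1, h3⟩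
  have hdisj : Disjoint (V.filter (· < v)) (insert v (V.filter fun u => v < u ∧ u < c v)) := by
    rw [Finset.disjoint_left]
    intro u hu
    simp only [Finset.mem_filter, Finset.mem_insert] at hu ⊢
    omega
  rw [rankSign, rankSign, hsplit, Finset.card_union_of_disjoint hdisj,
    Finset.card_insert_of_notMem (by simp), pow_add, pow_succ, heven.neg_one_pow]
  ring

theorem IsNCMatching.rankSign {c : ℤ → ℤ} (hc : IsNCMatching id V c) {v : ℤ} (hv : v ∈ V) :
    rankSign V (c v) = -rankSign V v := by
  rcases lt_or_gt_of_ne (hc.ne v hv) with h | h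
  · have := hc.rankSign_of_lt (hc.mem v hv) (by rw [hc.invol v hv]; exact h)
    rw [hc.invol v hv] at this
    rw [this, neg_neg]
  · exact hc.rankSign_of_lt hv h

theorem IsStack.isStackSign_rankSign (hV : IsStack V a e d W) (hS : ∀ x ∈ S, x.1 ∈ V) :
    IsStackSign a e d W S fun x => BK.rankSign V x.1 where
  outer := by
    rintro ⟨v, b⟩ hx
    cases b
    · simpa [BK.outer] using hV.bot.rankSign (hS _ hx)
    · simpa [BK.outer] using hV.top.rankSign (hS _ hx)
  inner := by
    rintro ⟨v, b⟩ hx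
    by_cases hv : v ∈ W
    · simp [BK.inner, hv]
    · simpa [BK.inner, hv] using hV.mid.rankSign (hS _ hx)

theorem IsStack.outer_outer (hV : IsStack V a e d W) {x : Pt} (hx : x.1 ∈ V) :
    outer a e (outer a e x) = x := by
  obtain ⟨v, _ | _⟩ := x
  · simpa [outer] using hV.bot.invol v hx
  · simpa [outer] using hV.top.invol v hx

theorem IsStack.outer_ne (hV : IsStack V a e d W) {x : Pt} (hx : x.1 ∈ V) :
    outer a e x ≠ x := by
  obtain ⟨v, _ | _⟩ := x
  · simpa [outer] using hV.bot.ne v hx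
  · simpa [outer] using hV.top.ne v hx

theorem IsStack.inner_inner (hV : IsStack V a e d W) {x : Pt} (hx : x.1 ∈ V) :
    inner d W (inner d W x) = x := by
  obtain ⟨v, b⟩ := x
  by_cases hv : v ∈ W
  · simp [inner, hv]
  · simpa [inner, hv, hV.vert v hx] using hV.mid.invol v hx

theorem IsStack.inner_ne (hV : IsStack V a e d W) {x : Pt} (hx : x.1 ∈ V) :
    inner d W x ≠ x := by
  obtain ⟨v, b⟩ := x
  by_cases hv : v ∈ W
  · simp [inner, hv]
  · simpa [inner, hv] using hV.mid.ne v hx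

/-- A circle meeting `U` is contained in `U` if one cannot leave `U` along its arcs. -/
theorem IsStackCircle.subset (hS : IsStackCircle V a e d W S) {U : Finset Pt} {x : Pt}
    (hxS : x ∈ S) (hxU : x ∈ U) (ho : ∀ y ∈ S, y ∈ U → outer a e y ∈ U)
    (hi : ∀ y ∈ S, y ∈ U → inner d W y ∈ U) : S ⊆ U := by
  have := hS.conn (S ∩ U) Finset.inter_subset_left ⟨x, Finset.mem_inter.2 ⟨hxS, hxU⟩⟩
    (fun y hy => Finset.mem_inter.2 ⟨hS.outer_mem y (Finset.mem_inter.1 hy).1,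
      ho y (Finset.mem_inter.1 hy).1 (Finset.mem_inter.1 hy).2⟩)
    (fun y hy => Finset.mem_inter.2 ⟨hS.inner_mem y (Finset.mem_inter.1 hy).1,
      hi y (Finset.mem_inter.1 hy).1 (Finset.mem_inter.1 hy).2⟩)
  exact Finset.inter_eq_left.1 this

theorem IsStackCircle.eq_of_mem (hS : IsStackCircle V a e d W S) (hT : IsStackCircle V a e d W T)
    {x : Pt} (hxS : x ∈ S) (hxT : x ∈ T) : S = T :=
  (hS.subset hxS hxT (fun y _ hy => hT.outer_mem y hy) fun y _ hy => hT.inner_mem y hy).antisymm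
    (hT.subset hxT hxS (fun y _ hy => hS.outer_mem y hy) fun y _ hy => hS.inner_mem y hy)

theorem IsStackCircle.disjoint (hS : IsStackCircle V a e d W S) (hT : IsStackCircle V a e d W T)
    (hne : S ≠ T) : Disjoint S T :=
  Finset.disjoint_left.2 fun _ hxS hxT => hne (hS.eq_of_mem hT hxS hxT)

/-- The circles near the middle arc `{i, d i}` before and after its surgery. -/
structure IsSurgery (V : Finset ℤ) (a e d : ℤ → ℤ) (W : Set ℤ) (i : ℤ)
    (Sb St Si Sj : Finset Pt) : Prop where
  before : IsStack V a e d W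
  after : IsStack V a e d (insert i (insert (d i) W))
  mem : i ∈ V
  notMem : i ∉ W
  lt : i < d i
  circ_b : IsStackCircle V a e d W Sb
  circ_t : IsStackCircle V a e d W St
  circ_i : IsStackCircle V a e d (insert i (insert (d i) W)) Si
  circ_j : IsStackCircle V a e d (insert i (insert (d i) W)) Sj
  mem_b : (i, false) ∈ Sb
  mem_t : (i, true) ∈ St
  mem_i : (i, false) ∈ Si
  mem_j : (d i, false) ∈ Sj

namespace IsSurgery

variable {i : ℤ} {Sb St Si Sj : Finset Pt} {ε' : Pt → ℤ}

theorem inner_eq (x : Pt) (h1 : x.1 ≠ i) (h2 : x.1 ≠ d i) :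
    inner d (insert i (insert (d i) W)) x = inner d W x := by
  simp [inner, h1, h2]

theorem mem_b' (h : IsSurgery V a e d W i Sb St Si Sj) : (d i, false) ∈ Sb :=
  h.circ_b.mid_mem h.mem_b h.notMem

theorem mem_t' (h : IsSurgery V a e d W i Sb St Si Sj) : (d i, true) ∈ St :=
  h.circ_t.mid_mem h.mem_t h.notMem

theorem mem_i' (h : IsSurgery V a e d W i Sb St Si Sj) : (i, true) ∈ Si :=
  h.circ_i.vert_mem h.mem_i (by simp)

theorem mem_j' (h : IsSurgery V a e d W i Sb St Si Sj) : (d i, true) ∈ Sj :=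
  h.circ_j.vert_mem h.mem_j (by simp)

theorem notMem' (h : IsSurgery V a e d W i Sb St Si Sj) : d i ∉ W :=
  fun hw => h.notMem ((h.before.vert i h.mem).1 hw)

theorem union_eq (h : IsSurgery V a e d W i Sb St Si Sj) : Si ∪ Sj = Sb ∪ St := by
  have hd := h.before.mid.invol i h.mem
  have ho : ∀ y ∈ Si ∪ Sj, outer a e y ∈ Si ∪ Sj := fun y hy => by
    rw [Finset.mem_union] at hy ⊢
    exact hy.imp (h.circ_i.outer_mem y) (h.circ_j.outer_mem y)
  have hi : ∀ y ∈ Si ∪ Sj, inner d W y ∈ Si ∪ Sj := by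
    rintro ⟨v, b⟩ hy
    rw [Finset.mem_union] at hy ⊢
    by_cases h1 : v = i
    · right; subst h1
      cases b <;> simp [inner, h.notMem, h.mem_j, h.mem_j']
    by_cases h2 : v = d i
    · left; subst h2
      cases b <;> simp [inner, h.notMem', hd, h.mem_i, h.mem_i']
    rw [← inner_eq (v, b) h1 h2]
    exact hy.imp (h.circ_i.inner_mem _) (h.circ_j.inner_mem _)
  have ho' : ∀ y ∈ Sb ∪ St, outer a e y ∈ Sb ∪ St := fun y hy => by
    rw [Finset.mem_union] at hy ⊢
    exact hy.imp (h.circ_b.outer_mem y) (h.circ_t.outer_mem y)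
  have hi' : ∀ y ∈ Sb ∪ St, inner d (insert i (insert (d i) W)) y ∈ Sb ∪ St := by
    rintro ⟨v, b⟩ hy
    by_cases h1 : v = i
    · subst h1
      cases b <;> simp [inner, h.mem_b, h.mem_t]
    by_cases h2 : v = d i
    · subst h2
      cases b <;> simp [inner, h.mem_b', h.mem_t']
    rw [inner_eq (v, b) h1 h2]
    rw [Finset.mem_union] at hy ⊢
    exact hy.imp (h.circ_b.inner_mem _) (h.circ_t.inner_mem _)
  refine Finset.Subset.antisymm (Finset.union_subset ?_ ?_) (Finset.union_subset ?_ ?_)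
  · exact h.circ_i.subset h.mem_i (Finset.mem_union_left _ h.mem_b) (fun y _ => ho' y)
      fun y _ => hi' y
  · exact h.circ_j.subset h.mem_j (Finset.mem_union_left _ h.mem_b') (fun y _ => ho' y)
      fun y _ => hi' y
  · exact h.circ_b.subset h.mem_b (Finset.mem_union_left _ h.mem_i) (fun y _ => ho y)
      fun y _ => hi y
  · exact h.circ_t.subset h.mem_t (Finset.mem_union_left _ h.mem_i') (fun y _ => ho y)
      fun y _ => hi y

/-- If the surgered pair lies on two circles, the surgery merges them. -/
theorem merge (h : IsSurgery V a e d W i Sb St Si Sj) (hne : Sb ≠ St) : Si = Sb ∪ St := by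
  by_cases hij : Si = Sj
  · rw [← h.union_eq, ← hij, Finset.union_self]
  exfalso
  have hbt := Finset.disjoint_left.1 (h.circ_b.disjoint h.circ_t hne)
  have hij := Finset.disjoint_left.1 (h.circ_i.disjoint h.circ_j hij)
  have e1 : Even (Si ∩ Sb).card := by
    refine even_card_of_involution _ (outer a e) ?_ ?_ ?_ <;> intro x hx <;>
      rw [Finset.mem_inter] at hx
    · exact Finset.mem_inter.2 ⟨h.circ_i.outer_mem x hx.1, h.circ_b.outer_mem x hx.2⟩
    · exact h.before.outer_outer (h.circ_b.mem x hx.2)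
    · exact h.before.outer_ne (h.circ_b.mem x hx.2)
  have e2 : Even ((Si ∩ Sb).erase (i, false)).card := by
    refine even_card_of_involution _ (inner d W) ?_ ?_ ?_ <;> rintro x hx <;>
      rw [Finset.mem_erase, Finset.mem_inter] at hx <;> obtain ⟨hxi, hx1, hx2⟩ := hx
    · have h1 : x.1 ≠ i := by
        obtain ⟨v, _ | _⟩ := x
        · simpa using hxi
        · rintro rfl; exact hbt hx2 h.mem_t
      have h2 : x.1 ≠ d i := by
        obtain ⟨v, _ | _⟩ := x
        · rintro rfl; exact hij hx1 h.mem_j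
        · rintro rfl; exact hij hx1 h.mem_j'
      refine Finset.mem_erase.2 ⟨fun hc => h2 ?_, Finset.mem_inter.2 ⟨?_, h.circ_b.inner_mem x hx2⟩⟩
      · rw [← h.before.inner_inner (h.circ_b.mem x hx2), hc]
        simp [inner, h.notMem]
      · rw [← inner_eq x h1 h2]; exact h.circ_i.inner_mem x hx1
    · exact h.before.inner_inner (h.circ_b.mem x hx2)
    · exact h.before.inner_ne (h.circ_b.mem x hx2)
  have hmem : (i, false) ∈ Si ∩ Sb := Finset.mem_inter.2 ⟨h.mem_i, h.mem_b⟩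
  rw [← Finset.card_erase_add_one hmem] at e1
  exact (Nat.even_add_one.1 e1) e2

theorem turn_sub (h : IsSurgery V a e d W i Sb St Si Sj) (x : Pt) :
    turn a e d W ε x - turn a e d (insert i (insert (d i) W)) ε x =
      if x.1 = i then -ε x else if x.1 = d i then ε x else 0 := by
  obtain ⟨v, b⟩ := x
  have hd := h.before.mid.invol i h.mem
  by_cases h1 : v = i
  · subst h1
    simp only [turn, inner, h.notMem, Set.mem_insert_iff, true_or, if_true, if_false, sub_self,
      Int.sign_zero, sign_sub_of_lt h.lt]
    ring
  by_cases h2 : v = d i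
  · subst h2
    simp only [turn, inner, h.notMem', Set.mem_insert_iff, true_or, or_true, if_true, if_false,
      sub_self, Int.sign_zero, hd, h1, sign_sub_of_gt h.lt]
    ring
  simp [turn, h1, h2, inner_eq (v, b) h1 h2]

/-- If the surgered pair lies on one circle, the surgery splits it. -/
theorem split (h : IsSurgery V a e d W i Sb St Si Sj) (heq : Sb = St) :
    Disjoint Si Sj ∧ Si ∪ Sj = Sb := by
  have hu := h.union_eq
  rw [← heq, Finset.union_self] at hu
  refine ⟨h.circ_i.disjoint h.circ_j fun hij => ?_, hu⟩
  rw [← hij, Finset.union_self] at hu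
  have hS := h.circ_i
  rw [hu] at hS
  obtain ⟨p, hp, hmax⟩ := Sb.exists_max_image Prod.fst ⟨_, h.mem_b⟩
  have k1 := circle_turning h.before h.circ_b
    (h.before.isStackSign_rankSign h.circ_b.mem) hp hmax
  have k2 := circle_turning h.after hS (h.after.isStackSign_rankSign h.circ_b.mem) hp hmax
  have k3 := congrArg₂ (· - ·) k1 k2
  simp only [← Finset.sum_sub_distrib, h.turn_sub, sub_self] at k3
  have hne : i ≠ d i := h.lt.ne
  rw [← Finset.sum_subset (s₁ := ({(i, false), (i, true), (d i, false), (d i, true)} : Finset Pt))]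
    at k3
  · rw [Finset.sum_insert (by simp [hne]), Finset.sum_insert (by simp [hne]),
      Finset.sum_insert (by simp), Finset.sum_singleton] at k3
    simp only [if_true, hne.symm, if_false, h.before.mid.rankSign h.mem] at k3
    have := rankSign_ne_zero (V := V) i
    omega
  · intro x hx
    simp only [Finset.mem_insert, Finset.mem_singleton] at hx
    rcases hx with rfl | rfl | rfl | rfl
    · exact h.mem_b
    · exact heq ▸ h.mem_t
    · exact h.mem_b'
    · exact heq ▸ h.mem_t'
  · rintro ⟨v, b⟩ _ hx
    simp only [Finset.mem_insert, Finset.mem_singleton, Prod.mk.injEq, not_or] at hx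
    have h1 : v ≠ i := by cases b <;> simp_all
    have h2 : v ≠ d i := by cases b <;> simp_all
    simp [h1, h2]

/-- The change of the signed count of arcs under a surgery is local. -/
theorem sum_turn_eq (h : IsSurgery V a e d W i Sb St Si Sj)
    (hε : ∀ x, x ∉ Sb ∪ St → ε x = ε' x) {n : ℤ}
    (hn : ∑ x ∈ Sb ∪ St, turn a e d (insert i (insert (d i) W)) ε' x =
      ∑ x ∈ Sb ∪ St, turn a e d W ε x + n) :
    ∑ x ∈ V ×ˢ Finset.univ, turn a e d (insert i (insert (d i) W)) ε' x =
      ∑ x ∈ V ×ˢ Finset.univ, turn a e d W ε x + n := by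
  have hsub : Sb ∪ St ⊆ V ×ˢ (Finset.univ : Finset Bool) := by
    intro x hx
    rcases Finset.mem_union.1 hx with hx | hx
    · simpa using h.circ_b.mem x hx
    · simpa using h.circ_t.mem x hx
  rw [← Finset.sum_sdiff hsub, ← Finset.sum_sdiff (f := turn a e d W ε) hsub, hn, ← add_assoc]
  congr 2
  refine Finset.sum_congr rfl fun x hx => ?_
  have hx := (Finset.mem_sdiff.1 hx).2
  have hloc : ∀ b, (i, b) ∈ Sb ∪ St ∧ (d i, b) ∈ Sb ∪ St := by
    rintro (_ | _)
    · exact ⟨Finset.mem_union_left _ h.mem_b, Finset.mem_union_left _ h.mem_b'⟩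
    · exact ⟨Finset.mem_union_right _ h.mem_t, Finset.mem_union_right _ h.mem_t'⟩
  have h1 : x.1 ≠ i := fun hc => hx (by have := (hloc x.2).1; rwa [← hc] at this)
  have h2 : x.1 ≠ d i := fun hc => hx (by have := (hloc x.2).2; rwa [← hc] at this)
  simp only [turn, inner_eq x h1 h2, hε x hx]

end IsSurgery

end Surgery

section Partner

variable {V : Finset ℤ} {a e dd c : CupDiagram} {R : Set (ℤ × ℤ)}

/-- A cup diagram without rays compatible with the vertex set `V`. -/
structure CupDiagram.IsPerfect (c : CupDiagram) (V : Finset ℤ) : Prop where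
  compatible : c.IsCompatible V
  rays : c.rays = ∅

/-- The other endpoint of the cup at a vertex. -/
noncomputable def partner (c : CupDiagram) (v : ℤ) : ℤ :=
  if h : ∃ w, (v, w) ∈ c.cups ∨ (w, v) ∈ c.cups then h.choose else v

namespace CupDiagram.IsPerfect

theorem lt (hc : c.IsPerfect V) {p : ℤ × ℤ} (hp : p ∈ c.cups) : p.1 < p.2 :=
  hc.compatible.1 p hp

theorem fst_mem (hc : c.IsPerfect V) {p : ℤ × ℤ} (hp : p ∈ c.cups) : p.1 ∈ V :=
  (hc.compatible.2.1 p hp).1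

theorem snd_mem (hc : c.IsPerfect V) {p : ℤ × ℤ} (hp : p ∈ c.cups) : p.2 ∈ V :=
  (hc.compatible.2.1 p hp).2

theorem eq_of_common (hc : c.IsPerfect V) {p q : ℤ × ℤ} (hp : p ∈ c.cups) (hq : q ∈ c.cups)
    (h : p.1 = q.1 ∨ p.1 = q.2 ∨ p.2 = q.1 ∨ p.2 = q.2) : p = q :=
  hc.compatible.2.2.2.2.1 p hp q hq h

theorem noncrossing (hc : c.IsPerfect V) {p q : ℤ × ℤ} (hp : p ∈ c.cups) (hq : q ∈ c.cups) :
    ¬(p.1 < q.1 ∧ q.1 < p.2 ∧ p.2 < q.2) :=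
  hc.compatible.2.2.2.2.2.2.1 p hp q hq

theorem exists_cup (hc : c.IsPerfect V) {v : ℤ} (hv : v ∈ V) :
    ∃ p ∈ c.cups, v = p.1 ∨ v = p.2 :=
  (hc.compatible.2.2.2.1 v hv).resolve_left (by simp [hc.rays])

theorem partner_spec (hc : c.IsPerfect V) {v : ℤ} (hv : v ∈ V) :
    (v, partner c v) ∈ c.cups ∨ (partner c v, v) ∈ c.cups := by
  have h : ∃ w, (v, w) ∈ c.cups ∨ (w, v) ∈ c.cups := by
    obtain ⟨⟨x, y⟩, hp, rfl | rfl⟩ := hc.exists_cup hv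
    · exact ⟨y, Or.inl hp⟩
    · exact ⟨x, Or.inr hp⟩
  rw [partner, dif_pos h]
  exact h.choose_spec

theorem eq_partner_iff (hc : c.IsPerfect V) {v w : ℤ} (hv : v ∈ V) :
    w = partner c v ↔ (v, w) ∈ c.cups ∨ (w, v) ∈ c.cups := by
  refine ⟨fun h => h ▸ hc.partner_spec hv, fun h => ?_⟩
  have := hc.partner_spec hv
  rcases h with h | h <;> rcases this with h' | h' <;>
    have h1 := hc.lt h <;> have h2 := hc.lt h' <;> have h3 := hc.eq_of_common h h' (by simp) <;>
    simp only [Prod.mk.injEq] at h1 h2 h3 <;> omega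

theorem partner_fst (hc : c.IsPerfect V) {p : ℤ × ℤ} (hp : p ∈ c.cups) : partner c p.1 = p.2 :=
  ((hc.eq_partner_iff (hc.fst_mem hp)).2 (Or.inl hp)).symm

theorem partner_snd (hc : c.IsPerfect V) {p : ℤ × ℤ} (hp : p ∈ c.cups) : partner c p.2 = p.1 :=
  ((hc.eq_partner_iff (hc.snd_mem hp)).2 (Or.inr hp)).symm

theorem isNCMatching (hc : c.IsPerfect V) : IsNCMatching id V (partner c) where
  mem x hx := by
    obtain ⟨p, hp, rfl | rfl⟩ := hc.exists_cup hx
    · exact hc.partner_fst hp ▸ hc.snd_mem hp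
    · exact hc.partner_snd hp ▸ hc.fst_mem hp
  invol x hx := by
    obtain ⟨p, hp, rfl | rfl⟩ := hc.exists_cup hx <;>
    simp [hc.partner_fst hp, hc.partner_snd hp]
  ne x hx := by
    obtain ⟨p, hp, rfl | rfl⟩ := hc.exists_cup hx
    · exact hc.partner_fst hp ▸ (hc.lt hp).ne'
    · exact hc.partner_snd hp ▸ (hc.lt hp).ne
  nc x hx u hu h1 h2 := by
    simp only [id]
    obtain ⟨p, hp, hxp⟩ := hc.exists_cup hx
    obtain ⟨q, hq, huq⟩ := hc.exists_cup hu
    have hne : p ≠ q := by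
      rintro rfl
      rcases hxp with rfl | rfl <;> rcases huq with rfl | rfl <;>
        simp_all [hc.partner_fst hp, hc.partner_snd hp]
    have k1 : ¬(p.1 = q.1 ∨ p.1 = q.2 ∨ p.2 = q.1 ∨ p.2 = q.2) := fun h =>
      hne (hc.eq_of_common hp hq h)
    have k2 := hc.noncrossing hp hq
    have k3 := hc.noncrossing hq hp
    have k4 := hc.lt hp
    have k5 := hc.lt hq
    rcases hxp with rfl | rfl <;> rcases huq with rfl | rfl <;>
      simp only [hc.partner_fst hp, hc.partner_snd hp, hc.partner_fst hq, hc.partner_snd hq] <;>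
      omega

end CupDiagram.IsPerfect

/-- `R` is a set of cups of `dd` containing all cups nested in one of its members. -/
structure IsMiddle (dd : CupDiagram) (R : Set (ℤ × ℤ)) : Prop where
  subset : R ⊆ dd.cups
  nested : ∀ r ∈ R, ∀ g ∈ dd.cups, r.1 < g.1 → g.2 < r.2 → g ∈ R

theorem IsMiddle.cups : IsMiddle dd dd.cups := ⟨le_rfl, fun _ _ _ hg _ _ => hg⟩

theorem IsMiddle.diff (hR : IsMiddle dd R) {γ : ℤ × ℤ} (hγ : Available R γ) :
    IsMiddle dd (R \ {γ}) where
  subset := Set.sdiff_subset.trans hR.subset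
  nested r hr g hg h1 h2 :=
    ⟨hR.nested r hr.1 g hg h1 h2, fun h => hγ.2 ⟨r, hr.1, hr.2, h ▸ h1, h ▸ h2⟩⟩

/-- The endpoints of the middle cups that have been surgered. -/
def vertSet (dd : CupDiagram) (R : Set (ℤ × ℤ)) : Set ℤ :=
  {v | ∃ g ∈ dd.cups, g ∉ R ∧ (v = g.1 ∨ v = g.2)}

theorem CupDiagram.IsPerfect.mem_vertSet (hd : dd.IsPerfect V) {g : ℤ × ℤ} (hg : g ∈ dd.cups) :
    (g.1 ∈ vertSet dd R ↔ g ∉ R) ∧ (g.2 ∈ vertSet dd R ↔ g ∉ R) := by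
  refine ⟨⟨?_, fun h => ⟨g, hg, h, Or.inl rfl⟩⟩, ⟨?_, fun h => ⟨g, hg, h, Or.inr rfl⟩⟩⟩ <;>
  · rintro ⟨q, hq, hqR, h⟩
    rw [hd.eq_of_common hg hq (by tauto)]
    exact hqR

theorem vertSet_diff (hd : dd.IsPerfect V) (hR : IsMiddle dd R) {γ : ℤ × ℤ} (hγ : γ ∈ R) :
    vertSet dd (R \ {γ}) = insert γ.1 (insert (partner dd γ.1) (vertSet dd R)) := by
  rw [hd.partner_fst (hR.subset hγ)]
  ext v
  simp only [vertSet, Set.mem_ofPred_eq, Set.mem_insert_iff, Set.mem_sdiff, Set.mem_singleton_iff,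
    not_and, not_not]
  constructor
  · rintro ⟨g, hg, h, hv⟩
    by_cases hgR : g ∈ R
    · rw [h hgR] at hv; tauto
    · exact Or.inr (Or.inr ⟨g, hg, hgR, hv⟩)
  · rintro (h | h | ⟨g, hg, h, hv⟩)
    · exact ⟨γ, hR.subset hγ, fun _ => rfl, Or.inl h⟩
    · exact ⟨γ, hR.subset hγ, fun _ => rfl, Or.inr h⟩
    · exact ⟨g, hg, fun h' => absurd h' h, hv⟩

theorem isStack (ha : a.IsPerfect V) (he : e.IsPerfect V) (hd : dd.IsPerfect V)
    (hR : IsMiddle dd R) :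
    IsStack V (partner a) (partner e) (partner dd) (vertSet dd R) where
  bot := ha.isNCMatching
  top := he.isNCMatching
  mid := hd.isNCMatching
  vert v hv := by
    obtain ⟨p, hp, rfl | rfl⟩ := hd.exists_cup hv <;>
    simp [hd.partner_fst hp, hd.partner_snd hp, hd.mem_vertSet hp]
  vert_nc v hv hvW w hw hwW := by
    obtain ⟨p, hp, hvp⟩ := hd.exists_cup hv
    obtain ⟨g, hg, hwg⟩ := hd.exists_cup hw
    have hpR : p ∈ R := by
      rcases hvp with rfl | rfl <;> simpa [hd.mem_vertSet hp] using hvW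
    have hgR : g ∉ R := by
      rcases hwg with rfl | rfl <;> simpa [hd.mem_vertSet hg] using hwW
    have hne : ¬(p.1 = g.1 ∨ p.1 = g.2 ∨ p.2 = g.1 ∨ p.2 = g.2) := fun h =>
      hgR (hd.eq_of_common hp hg h ▸ hpR)
    have k1 : ¬(p.1 < g.1 ∧ g.2 < p.2) := fun h => hgR (hR.nested p hpR g hg h.1 h.2)
    have k2 := hd.noncrossing hp hg
    have k3 := hd.noncrossing hg hp
    have k4 := hd.lt hp
    have k5 := hd.lt hg
    rcases hvp with rfl | rfl
    · rw [hd.partner_fst hp]; omega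
    · rw [hd.partner_snd hp]; omega

end Partner

section Circles

variable {V : Finset ℤ} {a e dd : CupDiagram} {R : Set (ℤ × ℤ)} {l0 : Weight}
  {o o' : Weight × Weight}

theorem mem_middle_iff (hd : dd.IsPerfect V) (hR : IsMiddle dd R) {v w : ℤ} (hv : v ∈ V) :
    ((v, w) ∈ R ∨ (w, v) ∈ R) ↔ v ∉ vertSet dd R ∧ w = partner dd v := by
  rw [hd.eq_partner_iff hv]
  constructor
  · rintro (h | h)
    · exact ⟨fun h' => (hd.mem_vertSet (hR.subset h)).1.1 h' h, Or.inl (hR.subset h)⟩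
    · exact ⟨fun h' => (hd.mem_vertSet (hR.subset h)).2.1 h' h, Or.inr (hR.subset h)⟩
  · rintro ⟨h1, h | h⟩
    · exact Or.inl (not_not.1 fun h' => h1 ((hd.mem_vertSet h).1.2 h'))
    · exact Or.inr (not_not.1 fun h' => h1 ((hd.mem_vertSet h).2.2 h'))

theorem sAdj_iff (ha : a.IsPerfect V) (he : e.IsPerfect V) (hd : dd.IsPerfect V)
    (hR : IsMiddle dd R) {x y : Pt} (hx : x.1 ∈ V) :
    SAdj a e dd R x y ↔ y = outer (partner a) (partner e) x ∨
      y = inner (partner dd) (vertSet dd R) x := by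
  obtain ⟨v, b⟩ := x
  obtain ⟨w, b'⟩ := y
  have h1 := ha.eq_partner_iff (w := w) hx
  have h2 := he.eq_partner_iff (w := w) hx
  have h3 := mem_middle_iff hd hR (w := w) hx
  have h4 : (∃ g ∈ dd.cups, g ∉ R ∧ (v = g.1 ∨ v = g.2)) ↔ v ∈ vertSet dd R := Iff.rfl
  have h5 : ((v, w) ∈ a.cups ∨ (w, v) ∈ a.cups ∨ (v, w) ∈ R ∨ (w, v) ∈ R) ↔
      w = partner a v ∨ v ∉ vertSet dd R ∧ w = partner dd v := by
    rw [h1, ← h3, or_assoc]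
  have h6 : ((v, w) ∈ R ∨ (w, v) ∈ R ∨ (v, w) ∈ e.cups ∨ (w, v) ∈ e.cups) ↔
      w = partner e v ∨ v ∉ vertSet dd R ∧ w = partner dd v := by
    rw [h2, ← h3, or_comm (a := (v, w) ∈ e.cups ∨ _), or_assoc]
  simp only [SAdj, h4, h5, h6, outer, inner]
  by_cases hv : v ∈ vertSet dd R <;> cases b <;> cases b' <;> simp [hv, eq_comm]

theorem SAdj.symm {x y : Pt} (h : SAdj a e dd R x y) : SAdj a e dd R y x := by
  rcases h with ⟨h1, h2, h⟩ | ⟨h1, h2, h⟩ | ⟨h1, h2, h⟩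
  · exact Or.inl ⟨h2, h1, by tauto⟩
  · exact Or.inr (Or.inl ⟨h2, h1, by tauto⟩)
  · exact Or.inr (Or.inr ⟨h1.symm, h2.symm, h1 ▸ h⟩)

/-- The finite set of points of the component of `x`. -/
noncomputable def circleFinset (V : Finset ℤ) (a e dd : CupDiagram) (R : Set (ℤ × ℤ)) (x : Pt) :
    Finset Pt :=
  (V ×ˢ Finset.univ).filter (· ∈ SComp a e dd R x)

theorem sComp_subset (ha : a.IsPerfect V) (he : e.IsPerfect V) (hd : dd.IsPerfect V)
    (hR : IsMiddle dd R) {x : Pt} {U : Set Pt} (hU : ∀ y ∈ U, y.1 ∈ V)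
    (ho : ∀ y ∈ U, outer (partner a) (partner e) y ∈ U)
    (hi : ∀ y ∈ U, inner (partner dd) (vertSet dd R) y ∈ U) (hx : x ∈ U) :
    SComp a e dd R x ⊆ U := by
  intro y hy
  induction hy with
  | refl => exact hx
  | tail _ h ih =>
    rcases (sAdj_iff ha he hd hR (hU _ ih)).1 h with rfl | rfl
    · exact ho _ ih
    · exact hi _ ih

theorem IsStack.outer_mem {a e d : ℤ → ℤ} {W : Set ℤ} (hV : IsStack V a e d W) {x : Pt}
    (hx : x.1 ∈ V) : (outer a e x).1 ∈ V := by
  obtain ⟨v, _ | _⟩ := x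
  · exact hV.bot.mem v hx
  · exact hV.top.mem v hx

theorem IsStack.inner_mem {a e d : ℤ → ℤ} {W : Set ℤ} (hV : IsStack V a e d W) {x : Pt}
    (hx : x.1 ∈ V) : (inner d W x).1 ∈ V := by
  rw [inner]
  split_ifs
  · exact hx
  · exact hV.mid.mem _ hx

theorem coe_circleFinset (ha : a.IsPerfect V) (he : e.IsPerfect V) (hd : dd.IsPerfect V)
    (hR : IsMiddle dd R) {x : Pt} (hx : x.1 ∈ V) :
    (circleFinset V a e dd R x : Set Pt) = SComp a e dd R x := by
  have hV := isStack ha he hd hR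
  ext y
  simp only [circleFinset, Finset.coe_filter, Finset.mem_product, Finset.mem_univ, and_true,
    Set.mem_ofPred_eq, and_iff_right_iff_imp]
  exact fun hy => sComp_subset ha he hd hR (U := {y | y.1 ∈ V}) (fun _ h => h)
    (fun _ => hV.outer_mem) (fun _ => hV.inner_mem) hx hy

theorem isStackCircle (ha : a.IsPerfect V) (he : e.IsPerfect V) (hd : dd.IsPerfect V)
    (hR : IsMiddle dd R) {x : Pt} (hx : x.1 ∈ V) :
    IsStackCircle V (partner a) (partner e) (partner dd) (vertSet dd R)
      (circleFinset V a e dd R x) := by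
  have hV := isStack ha he hd hR
  have hmem : ∀ y ∈ circleFinset V a e dd R x, y.1 ∈ V := fun y hy => by
    simpa using (Finset.mem_filter.1 hy).1
  have hcoe : ∀ y, y ∈ circleFinset V a e dd R x ↔
      Relation.ReflTransGen (SAdj a e dd R) x y := fun y => by
    rw [← Finset.mem_coe, coe_circleFinset ha he hd hR hx]; rfl
  refine ⟨hmem, fun y hy => ?_, fun y hy => ?_, fun U hU ⟨u, hu⟩ ho hi => ?_⟩
  · exact (hcoe _).2 (((hcoe y).1 hy).tail ((sAdj_iff ha he hd hR (hmem y hy)).2 (Or.inl rfl)))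
  · exact (hcoe _).2 (((hcoe y).1 hy).tail ((sAdj_iff ha he hd hR (hmem y hy)).2 (Or.inr rfl)))
  · refine hU.antisymm fun y hy => ?_
    have : Std.Symm (SAdj a e dd R) := ⟨fun _ _ => SAdj.symm⟩
    have hux := Relation.ReflTransGen.stdSymm.symm _ _ ((hcoe u).1 (hU hu))
    exact sComp_subset ha he hd hR (U := U) (fun z hz => hmem z (hU hz)) ho hi hu
      (hux.trans ((hcoe y).1 hy))

theorem mem_circleFinset {x : Pt} (hx : x.1 ∈ V) : x ∈ circleFinset V a e dd R x :=
  Finset.mem_filter.2 ⟨by simpa using hx, Relation.ReflTransGen.refl⟩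

/-- `∨` counts as `1` and `∧` as `-1`. -/
def Symb.sgn : Symb → ℤ
  | dn => 1
  | up => -1
  | _ => 0

/-- The sign of the label of a point. -/
def labSign (o : Weight × Weight) (x : Pt) : ℤ := (plab o x).sgn

theorem OneUpOneDn.sgn {w : Weight} {g : ℤ × ℤ} (h : OneUpOneDn w g) :
    (w.lab g.1).sgn = -(w.lab g.2).sgn := by
  rcases h with ⟨h1, h2⟩ | ⟨h1, h2⟩ <;> simp [h1, h2, Symb.sgn]

theorem SOriented.isStackSign (ho : SOriented l0 a e dd R o) (ha : a.IsPerfect V)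
    (he : e.IsPerfect V) (hd : dd.IsPerfect V) (hR : IsMiddle dd R) {S : Finset Pt}
    (hS : ∀ x ∈ S, x.1 ∈ V) :
    IsStackSign (partner a) (partner e) (partner dd) (vertSet dd R) S (labSign o) := by
  obtain ⟨-, -, hoa, hob, hot, hoe, hov⟩ := ho
  have key : ∀ {w : Weight} {v v' : ℤ} {C : Set (ℤ × ℤ)}, (∀ g ∈ C, OneUpOneDn w g) →
      (v, v') ∈ C ∨ (v', v) ∈ C → (w.lab v').sgn = -(w.lab v).sgn := by
    rintro w v v' C hC (h | h)
    · rw [(hC _ h).sgn, neg_neg]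
    · exact (hC _ h).sgn
  refine ⟨?_, ?_⟩
  · rintro ⟨v, b⟩ hx
    cases b
    · exact key hoa (ha.partner_spec (hS _ hx))
    · exact key hoe (he.partner_spec (hS _ hx))
  · rintro ⟨v, b⟩ hx
    by_cases hv : v ∈ vertSet dd R
    · have : o.1.lab v = o.2.lab v := by
        obtain ⟨g, hg, hgR, rfl | rfl⟩ := hv
        · exact (hov g hg hgR).1
        · exact (hov g hg hgR).2
      cases b <;> simp [inner, hv, labSign, plab, this]
    · have := (mem_middle_iff hd hR (hS _ hx)).2 ⟨hv, rfl⟩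
      simp only [inner, hv, if_false]
      cases b
      · exact key hob this
      · exact key hot this

end Circles

section Degree

variable {V : Finset ℤ} {a e dd c : CupDiagram} {R : Set (ℤ × ℤ)} {l0 : Weight}
  {o o' : Weight × Weight} {γ : ℤ × ℤ}

theorem sum_turn_circleFinset (ha : a.IsPerfect V) (he : e.IsPerfect V) (hd : dd.IsPerfect V)
    (hR : IsMiddle dd R) (ho : SOriented l0 a e dd R o) {x p : Pt} (hx : x.1 ∈ V)
    (hp : RightmostPt (SComp a e dd R x) p) :
    ∑ y ∈ circleFinset V a e dd R x,
      turn (partner a) (partner e) (partner dd) (vertSet dd R) (labSign o) y =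
        4 * (plab o p).sgn := by
  rw [← coe_circleFinset ha he hd hR hx] at hp
  have hS := isStackCircle ha he hd hR hx
  exact circle_turning (isStack ha he hd hR) hS (ho.isStackSign ha he hd hR hS.mem) hp.1 hp.2

theorem IsClockwise.sum_turn (ha : a.IsPerfect V) (he : e.IsPerfect V) (hd : dd.IsPerfect V)
    (hR : IsMiddle dd R) (ho : SOriented l0 a e dd R o) {x : Pt} (hx : x.1 ∈ V)
    (h : IsClockwise o (SComp a e dd R x)) :
    ∑ y ∈ circleFinset V a e dd R x,
      turn (partner a) (partner e) (partner dd) (vertSet dd R) (labSign o) y = 4 := by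
  obtain ⟨p, hp, h⟩ := h
  simp [sum_turn_circleFinset ha he hd hR ho hx hp, h, Symb.sgn]

theorem IsAnticlockwise.sum_turn (ha : a.IsPerfect V) (he : e.IsPerfect V) (hd : dd.IsPerfect V)
    (hR : IsMiddle dd R) (ho : SOriented l0 a e dd R o) {x : Pt} (hx : x.1 ∈ V)
    (h : IsAnticlockwise o (SComp a e dd R x)) :
    ∑ y ∈ circleFinset V a e dd R x,
      turn (partner a) (partner e) (partner dd) (vertSet dd R) (labSign o) y = -4 := by
  obtain ⟨p, hp, h⟩ := h
  simp [sum_turn_circleFinset ha he hd hR ho hx hp, h, Symb.sgn]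

theorem isSurgery (ha : a.IsPerfect V) (he : e.IsPerfect V) (hd : dd.IsPerfect V)
    (hR : IsMiddle dd R) (hγ : Available R γ) :
    IsSurgery V (partner a) (partner e) (partner dd) (vertSet dd R) γ.1
      (circleFinset V a e dd R (γ.1, false)) (circleFinset V a e dd R (γ.1, true))
      (circleFinset V a e dd (R \ {γ}) (γ.1, false))
      (circleFinset V a e dd (R \ {γ}) (γ.2, false)) := by
  have hγd := hR.subset hγ.1
  have h1 := hd.fst_mem hγd
  have h2 := hd.snd_mem hγd
  have hR' := hR.diff hγ
  have hv := vertSet_diff hd hR hγ.1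
  exact
    { before := isStack ha he hd hR
      after := hv ▸ isStack ha he hd hR'
      mem := h1
      notMem := fun h => (hd.mem_vertSet hγd).1.1 h hγ.1
      lt := hd.partner_fst hγd ▸ hd.lt hγd
      circ_b := isStackCircle ha he hd hR h1
      circ_t := isStackCircle ha he hd hR h1
      circ_i := hv ▸ isStackCircle ha he hd hR' h1
      circ_j := hv ▸ isStackCircle ha he hd hR' h2
      mem_b := mem_circleFinset h1
      mem_t := mem_circleFinset h1
      mem_i := mem_circleFinset h1
      mem_j := (hd.partner_fst hγd).symm ▸ mem_circleFinset h2 }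

/-- The merge and split rules up to signs. -/
theorem stepCoeff_ne_zero {K : Type*} [Field K] (h : stepCoeff K l0 a e dd R γ o o' ≠ 0) :
    SOriented l0 a e dd R o ∧ SOriented l0 a e dd (R \ {γ}) o' ∧
    (∀ p, p ∉ SComp a e dd R (γ.1, false) ∪ SComp a e dd R (γ.1, true) → plab o p = plab o' p) ∧
    (SComp a e dd R (γ.1, false) ≠ SComp a e dd R (γ.1, true) ∧
      (IsAnticlockwise o (SComp a e dd R (γ.1, false)) ∧
          IsAnticlockwise o (SComp a e dd R (γ.1, true)) ∧
          IsAnticlockwise o' (SComp a e dd (R \ {γ}) (γ.1, false)) ∨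
        IsClockwise o (SComp a e dd R (γ.1, false)) ∧
          IsAnticlockwise o (SComp a e dd R (γ.1, true)) ∧
          IsClockwise o' (SComp a e dd (R \ {γ}) (γ.1, false)) ∨
        IsAnticlockwise o (SComp a e dd R (γ.1, false)) ∧
          IsClockwise o (SComp a e dd R (γ.1, true)) ∧
          IsClockwise o' (SComp a e dd (R \ {γ}) (γ.1, false))) ∨
    SComp a e dd R (γ.1, false) = SComp a e dd R (γ.1, true) ∧
      (IsAnticlockwise o (SComp a e dd R (γ.1, false)) ∧
          IsClockwise o' (SComp a e dd (R \ {γ}) (γ.1, false)) ∧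
          IsAnticlockwise o' (SComp a e dd (R \ {γ}) (γ.2, false)) ∨
        IsAnticlockwise o (SComp a e dd R (γ.1, false)) ∧
          IsAnticlockwise o' (SComp a e dd (R \ {γ}) (γ.1, false)) ∧
          IsClockwise o' (SComp a e dd (R \ {γ}) (γ.2, false)) ∨
        IsClockwise o (SComp a e dd R (γ.1, false)) ∧
          IsClockwise o' (SComp a e dd (R \ {γ}) (γ.1, false)) ∧
          IsClockwise o' (SComp a e dd (R \ {γ}) (γ.2, false)))) := by
  simp only [stepCoeff, Ne, ite_eq_left_iff, Classical.not_imp, not_or, not_not] at h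
  obtain ⟨⟨h1, h2, h3⟩, h⟩ := h
  refine ⟨h1, h2, h3, ?_⟩
  clear h1 h2 h3
  by_cases hne : SComp a e dd R (γ.1, false) = SComp a e dd R (γ.1, true)
  · rw [if_neg (not_not.2 hne)] at h
    refine Or.inr ⟨hne, ?_⟩
    contrapose! h
    grind
  · rw [if_pos hne] at h
    refine Or.inl ⟨hne, ?_⟩
    contrapose! h
    grind

/-- A surgery raises the signed count of arcs by `4`. -/
theorem sum_turn_of_stepCoeff_ne_zero {K : Type*} [Field K] (ha : a.IsPerfect V)
    (he : e.IsPerfect V) (hd : dd.IsPerfect V) (hR : IsMiddle dd R) (hγ : Available R γ)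
    (h : stepCoeff K l0 a e dd R γ o o' ≠ 0) :
    ∑ x ∈ V ×ˢ Finset.univ,
        turn (partner a) (partner e) (partner dd) (vertSet dd (R \ {γ})) (labSign o') x =
      ∑ x ∈ V ×ˢ Finset.univ,
        turn (partner a) (partner e) (partner dd) (vertSet dd R) (labSign o) x + 4 := by
  have hs := isSurgery ha he hd hR hγ
  have hγd := hR.subset hγ.1
  have h1 := hd.fst_mem hγd
  have h2 := hd.snd_mem hγd
  have hR' := hR.diff hγ
  have hv := vertSet_diff hd hR hγ.1
  have hb := coe_circleFinset ha he hd hR (x := (γ.1, false)) h1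
  have ht := coe_circleFinset ha he hd hR (x := (γ.1, true)) h1
  obtain ⟨ho, ho', hlab, h⟩ := stepCoeff_ne_zero h
  rw [hv]
  refine hs.sum_turn_eq (fun x hx => ?_) ?_
  · rw [labSign, labSign, hlab x]
    rwa [← hb, ← ht, ← Finset.coe_union, Finset.mem_coe]
  rw [← hv]
  have hcw := fun {x : Pt} (hx : x.1 ∈ V) => IsClockwise.sum_turn ha he hd hR ho hx
  have hac := fun {x : Pt} (hx : x.1 ∈ V) => IsAnticlockwise.sum_turn ha he hd hR ho hx
  have hcw' := fun {x : Pt} (hx : x.1 ∈ V) => IsClockwise.sum_turn ha he hd hR' ho' hx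
  have hac' := fun {x : Pt} (hx : x.1 ∈ V) => IsAnticlockwise.sum_turn ha he hd hR' ho' hx
  rcases h with ⟨hne, h⟩ | ⟨heq, h⟩
  · rw [← hb, ← ht, Ne, Finset.coe_inj] at hne
    nth_rw 1 [← hs.merge hne]
    rw [Finset.sum_union (hs.circ_b.disjoint hs.circ_t hne)]
    rcases h with ⟨k1, k2, k3⟩ | ⟨k1, k2, k3⟩ | ⟨k1, k2, k3⟩
    · rw [hac h1 k1, hac h1 k2, hac' h1 k3]; rfl
    · rw [hcw h1 k1, hac h1 k2, hcw' h1 k3]; rfl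
    · rw [hac h1 k1, hcw h1 k2, hcw' h1 k3]; rfl
  · rw [← hb, ← ht, Finset.coe_inj] at heq
    obtain ⟨hdisj, hu⟩ := hs.split heq
    rw [← heq, Finset.union_self]
    nth_rw 1 [← hu]
    rw [Finset.sum_union hdisj]
    rcases h with ⟨k1, k2, k3⟩ | ⟨k1, k2, k3⟩ | ⟨k1, k2, k3⟩
    · rw [hac h1 k1, hcw' h1 k2, hac' h2 k3]; rfl
    · rw [hac h1 k1, hac' h1 k2, hcw' h2 k3]
    · rw [hcw h1 k1, hcw' h1 k2, hcw' h2 k3]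

/-- The endpoints of the cups of `R` weighted by orientation count the clockwise cups of `R`. -/
theorem sum_sign_eq_ncard (hc : c.IsPerfect V) (hR : IsMiddle c R) {w : Weight}
    (hw : ∀ g ∈ R, OneUpOneDn w g) :
    ∑ v ∈ V with v ∉ vertSet c R, (1 + (w.lab v).sgn * Int.sign (v - partner c v)) =
      4 * ({p ∈ R | w.lab p.2 = Symb.dn}.ncard : ℤ) := by
  have hfin : R.Finite := (V ×ˢ V).finite_toSet.subset fun p hp => by
    simp [hc.fst_mem (hR.subset hp), hc.snd_mem (hR.subset hp)]
  lift R to Finset (ℤ × ℤ) using hfin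
  have hcup : ∀ p ∈ R, p ∈ c.cups := fun p hp => hR.subset hp
  have hV : V.filter (· ∉ vertSet c R) = R.image Prod.fst ∪ R.image Prod.snd := by
    ext v
    simp only [Finset.mem_filter, Finset.mem_union, Finset.mem_image]
    constructor
    · rintro ⟨hv, hvW⟩
      obtain ⟨p, hp, rfl | rfl⟩ := hc.exists_cup hv
      · exact Or.inl ⟨p, by simpa [hc.mem_vertSet hp] using hvW, rfl⟩
      · exact Or.inr ⟨p, by simpa [hc.mem_vertSet hp] using hvW, rfl⟩
    · rintro (⟨p, hp, rfl⟩ | ⟨p, hp, rfl⟩)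
      · exact ⟨hc.fst_mem (hcup p hp), fun h => (hc.mem_vertSet (hcup p hp)).1.1 h hp⟩
      · exact ⟨hc.snd_mem (hcup p hp), fun h => (hc.mem_vertSet (hcup p hp)).2.1 h hp⟩
  have hdisj : Disjoint (R.image Prod.fst) (R.image Prod.snd) := by
    simp only [Finset.disjoint_left, Finset.mem_image, not_exists, not_and]
    rintro _ ⟨p, hp, rfl⟩ q hq h
    have hpq := hc.eq_of_common (hcup p hp) (hcup q hq) (by simp [h])
    exact (hc.lt (hcup q hq)).ne' (hpq ▸ h)
  rw [hV, Finset.sum_union hdisj,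
    Finset.sum_image fun p hp q hq h => hc.eq_of_common (hcup p hp) (hcup q hq) (Or.inl h),
    Finset.sum_image fun p hp q hq h => hc.eq_of_common (hcup p hp) (hcup q hq) (by simp [h]),
    ← Finset.sum_add_distrib]
  have hset : {p | p ∈ (R : Set (ℤ × ℤ)) ∧ w.lab p.2 = Symb.dn} =
      (R.filter fun p => w.lab p.2 = Symb.dn : Set (ℤ × ℤ)) := by ext; simp
  rw [hset, Set.ncard_coe_finset, Finset.card_filter, Nat.cast_sum, Finset.mul_sum]
  refine Finset.sum_congr rfl fun p hp => ?_
  have hlt := hc.lt (hcup p hp)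
  rw [hc.partner_fst (hcup p hp), hc.partner_snd (hcup p hp), sign_sub_of_lt hlt,
    sign_sub_of_gt hlt]
  rcases hw p hp with ⟨h1, h2⟩ | ⟨h1, h2⟩ <;> simp [h1, h2, Symb.sgn]

/-- The number of clockwise arcs of a stacked diagram. -/
noncomputable def stackDeg (a e : CupDiagram) (R : Set (ℤ × ℤ)) (o : Weight × Weight) : ℕ :=
  {p ∈ a.cups | o.1.lab p.2 = Symb.dn}.ncard + {p ∈ R | o.1.lab p.2 = Symb.dn}.ncard +
    ({p ∈ R | o.2.lab p.2 = Symb.dn}.ncard + {p ∈ e.cups | o.2.lab p.2 = Symb.dn}.ncard)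

theorem four_mul_stackDeg (ha : a.IsPerfect V) (he : e.IsPerfect V) (hd : dd.IsPerfect V)
    (hR : IsMiddle dd R) (ho : SOriented l0 a e dd R o) :
    4 * (stackDeg a e R o : ℤ) =
      ∑ x ∈ V ×ˢ Finset.univ,
        turn (partner a) (partner e) (partner dd) (vertSet dd R) (labSign o) x +
      2 * V.card + 2 * (V.filter (· ∉ vertSet dd R)).card := by
  obtain ⟨-, -, hoa, hob, hot, hoe, -⟩ := ho
  have k1 := sum_sign_eq_ncard ha IsMiddle.cups hoa
  have k2 := sum_sign_eq_ncard hd hR hob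
  have k3 := sum_sign_eq_ncard hd hR hot
  have k4 := sum_sign_eq_ncard he IsMiddle.cups hoe
  have hempty : ∀ c : CupDiagram, V.filter (· ∉ vertSet c c.cups) = V := fun c =>
    Finset.filter_true_of_mem fun v _ ⟨g, hg, hg', _⟩ => hg' hg
  rw [hempty] at k1 k4
  rw [stackDeg]
  push_cast
  simp only [mul_add, ← k1, ← k2, ← k3, ← k4, Finset.sum_add_distrib, Finset.sum_product,
    Fintype.sum_bool, Finset.sum_const, nsmul_eq_mul, mul_one, Finset.sum_filter, turn, labSign,
    plab, outer, inner]
  have key : ∀ w : Weight, ∀ b : Bool, ∑ v ∈ V, (w.lab v).sgn *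
      Int.sign (v - (if v ∈ vertSet dd R then (v, !b) else (partner dd v, b)).1) =
      ∑ v ∈ V, if v ∉ vertSet dd R then (w.lab v).sgn * Int.sign (v - partner dd v) else 0 :=
    fun w b => Finset.sum_congr rfl fun v _ => by split_ifs <;> simp_all
  simp only [if_true, Bool.false_eq_true, if_false, key]
  ring

theorem card_filter_vertSet_diff (hd : dd.IsPerfect V) (hR : IsMiddle dd R) (hγ : γ ∈ R) :
    (V.filter (· ∉ vertSet dd R)).card = (V.filter (· ∉ vertSet dd (R \ {γ}))).card + 2 := by
  have hγd := hR.subset hγ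
  have hne := (hd.lt hγd).ne
  have hm := hd.mem_vertSet (R := R) hγd
  have : V.filter (· ∉ vertSet dd R) =
      insert γ.1 (insert γ.2 (V.filter (· ∉ vertSet dd (R \ {γ})))) := by
    ext v
    simp only [vertSet_diff hd hR hγ, hd.partner_fst hγd, Finset.mem_filter, Finset.mem_insert,
      Set.mem_insert_iff]
    by_cases h1 : v = γ.1
    · subst h1; simp [hm, hγ, hd.fst_mem hγd]
    by_cases h2 : v = γ.2
    · subst h2; simp [hm, hγ, hd.snd_mem hγd]
    simp [h1, h2]
  rw [this, Finset.card_insert_of_notMem, Finset.card_insert_of_notMem] <;>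
    simp [vertSet_diff hd hR hγ, hd.partner_fst hγd, hne]

theorem stackDeg_of_stepCoeff_ne_zero {K : Type*} [Field K] (ha : a.IsPerfect V)
    (he : e.IsPerfect V) (hd : dd.IsPerfect V) (hR : IsMiddle dd R) (hγ : Available R γ)
    (h : stepCoeff K l0 a e dd R γ o o' ≠ 0) : stackDeg a e (R \ {γ}) o' = stackDeg a e R o := by
  have k1 := sum_turn_of_stepCoeff_ne_zero ha he hd hR hγ h
  obtain ⟨ho, ho', -⟩ := stepCoeff_ne_zero h
  have k2 := four_mul_stackDeg ha he hd hR ho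
  have k3 := four_mul_stackDeg ha he hd (hR.diff hγ) ho'
  have k4 := card_filter_vertSet_diff hd hR hγ.1
  omega

theorem stackDeg_of_multAlong_ne_zero {K : Type*} [Field K] (ha : a.IsPerfect V)
    (he : e.IsPerfect V) (hd : dd.IsPerfect V) {n : ℕ} (L : List (ℤ × ℤ)) :
    ∀ (R : Set (ℤ × ℤ)) (f : Weight × Weight → K), IsMiddle dd R → IsLeftmostOrder L R →
      (∀ o, f o ≠ 0 → stackDeg a e R o = n) →
      ∀ o, multAlong K l0 a e dd L R f o ≠ 0 → stackDeg a e ∅ o = n := by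
  induction L with
  | nil =>
    rintro R f - (rfl : R = ∅) hf o ho
    exact hf o ho
  | cons γ L ih =>
    rintro R f hR ⟨hγ, -, hL⟩ hf o ho
    refine ih _ _ (hR.diff hγ) hL (fun o' ho' => ?_) o ho
    obtain ⟨o₁, ho₁⟩ := not_forall.1 (mt finsum_eq_zero_of_forall_eq_zero ho')
    rw [stackDeg_of_stepCoeff_ne_zero ha he hd hR hγ (left_ne_zero_of_mul ho₁)]
    exact hf o₁ (right_ne_zero_of_mul ho₁)

theorem Weight.Equiv.vertices_eq {l m : Weight} (h : l.Equiv m) : m.vertices = l.vertices := by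
  ext i
  have h1 := h.1 i
  have h2 := h.2.1 i
  simp only [Weight.vertices, Set.mem_ofPred_eq]
  cases hl : l.lab i <;> cases hm : m.lab i <;> simp_all

theorem Weight.finite_vertices (l : Weight) : l.vertices.Finite :=
  l.finite.subset fun i hi => by rcases hi with hi | hi <;> simp [hi]

end Degree

/-- The multiplication of the Blanchet–Khovanov algebra is homogeneous of degree `0`:
if the basis vector `underline λ ν″ overline η` occurs with nonzero coefficient in
`mult((underline λ ν overline μ) ⊗ (underline μ ν′ overline η))` (computed by the
surgery procedure along the leftmost order of cup–cap pairs), then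
`deg(underline λ ν″ overline η) = deg(underline λ ν overline μ) +
deg(underline μ ν′ overline η)`. -/
theorem mult_homogeneous_degree_zero (K : Type*) [Field K]
    (l0 wl wm wh ν ν' : Weight) (hbal : l0.Balanced)
    (hwl : l0.Equiv wl) (hwm : l0.Equiv wm) (hwh : l0.Equiv wh)
    (hν : l0.Equiv ν) (hν' : l0.Equiv ν')
    (a dd e : CupDiagram)
    (ha : IsLowerDiagram a wl) (hdd : IsLowerDiagram dd wm) (he : IsLowerDiagram e wh)
    (har : a.rays = ∅) (hddr : dd.rays = ∅) (her : e.rays = ∅)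
    (hx1 : a.Oriented ν) (hx2 : dd.Oriented ν)
    (hy1 : dd.Oriented ν') (hy2 : e.Oriented ν')
    (L : List (ℤ × ℤ)) (hL : IsLeftmostOrder L dd.cups) :
    ∀ ν'' : Weight,
      multAlong K l0 a e dd L dd.cups (basisInit K ν ν') (ν'', ν'') ≠ 0 →
      degCirc a e ν'' = degCirc a dd ν + degCirc dd e ν' := by
  set V : Finset ℤ := l0.finite_vertices.toFinset with hV
  have hperf : ∀ {c : CupDiagram} {w : Weight}, l0.Equiv w → IsLowerDiagram c w → c.rays = ∅ →
      c.IsPerfect V := fun hw hc hr =>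
    ⟨by rw [hV, Set.Finite.coe_toFinset, ← hw.vertices_eq]; exact hc.1, hr⟩
  intro ν'' h
  have hdeg := stackDeg_of_multAlong_ne_zero (hperf hwl ha har) (hperf hwh he her)
    (hperf hwm hdd hddr) (n := degCirc a dd ν + degCirc dd e ν') L dd.cups _ IsMiddle.cups hL
    (fun o ho => ?_) _ h
  · rw [← hdeg]
    simp [degCirc, stackDeg]
  · have ho : o = (ν, ν') := by
      by_contra hne
      exact ho (if_neg hne)
    rw [ho, stackDeg, degCirc, degCirc]

end BK
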